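/- Let 0 < γ < 1 be fixed, let α be real, let h, m, d be positive integers, and let N₁ < N₂ ≤ 2N₁ be real numbers with N₁ ≥ 2 and d ≤ N₁. Set f(l) = αhd²l² − m d^γ l^γ. Then Σ_{N₁/d < l ≤ N₂/d} e(f(l)) ≪ m^{1/6} d^{−1/2} N₁^{γ/6 + 1/2} + m^{−1/3} d^{−1} N₁^{1 − γ/3}, where the sum is over integers l in the indicated range and the implied constant depends only on γ. -/

import Mathlib

/-- `e2pi x = e^{2πix}`. -/
noncomputable def e2pi (x : ℝ) : ℂ := Complex.exp (2 * Real.pi * Complex.I * x)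

open Finset

theorem norm_e2pi (x : ℝ) : ‖e2pi x‖ = 1 := by
  have : (2 * Real.pi * Complex.I * x : ℂ) = ((2 * Real.pi * x : ℝ) : ℂ) * Complex.I := by
    push_cast; ring
  rw [e2pi, this, Complex.norm_exp_ofReal_mul_I]

theorem e2pi_add (x y : ℝ) : e2pi (x + y) = e2pi x * e2pi y := by
  rw [e2pi, e2pi, e2pi, ← Complex.exp_add]
  push_cast
  ring_nf

theorem conj_e2pi (x : ℝ) : (starRingEnd ℂ) (e2pi x) = e2pi (-x) := by
  rw [e2pi, e2pi, ← Complex.exp_conj]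
  simp [Complex.conj_ofNat]

theorem e2pi_int (k : ℤ) : e2pi k = 1 := by
  rw [e2pi, Complex.exp_eq_one_iff]
  exact ⟨k, by push_cast; ring⟩

theorem norm_sum_e2pi_le (f : ℕ → ℝ) (s : Finset ℕ) : ‖∑ n ∈ s, e2pi (f n)‖ ≤ s.card := by
  refine (norm_sum_le _ _).trans ?_
  simp [norm_e2pi]

/-- Half of the cotangent of `π x`. -/
noncomputable def halfCot (x : ℝ) : ℝ := Real.cos (Real.pi * x) / Real.sin (Real.pi * x) / 2

theorem sin_pi_mul_pos {x : ℝ} (h0 : 0 < x) (h1 : x < 1) : 0 < Real.sin (Real.pi * x) :=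
  Real.sin_pos_of_pos_of_lt_pi (by positivity) (by nlinarith [Real.pi_pos])

theorem two_mul_le_sin_pi_mul {x Δ : ℝ} (hΔ : 0 < Δ) (h0 : Δ ≤ x) (h1 : x ≤ 1 - Δ) :
    2 * Δ ≤ Real.sin (Real.pi * x) := by
  have hpi := Real.pi_pos
  rcases le_total x (1 / 2) with h | h
  · have := Real.mul_le_sin (x := Real.pi * x) (by nlinarith) (by nlinarith)
    have h2 : 2 / Real.pi * (Real.pi * x) = 2 * x := by field_simp
    linarith
  · have := Real.mul_le_sin (x := Real.pi - Real.pi * x) (by nlinarith) (by nlinarith)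
    have h2 : 2 / Real.pi * (Real.pi - Real.pi * x) = 2 * (1 - x) := by field_simp
    rw [Real.sin_pi_sub] at this
    linarith

theorem halfCot_anti {a b : ℝ} (h0 : 0 < a) (hab : a ≤ b) (h1 : b < 1) :
    halfCot b ≤ halfCot a := by
  have ha := sin_pi_mul_pos h0 (by linarith)
  have hb := sin_pi_mul_pos (by linarith) h1
  have hs : 0 ≤ Real.sin (Real.pi * b - Real.pi * a) :=
    Real.sin_nonneg_of_nonneg_of_le_pi (by nlinarith [Real.pi_pos]) (by nlinarith [Real.pi_pos])
  rw [Real.sin_sub] at hs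
  unfold halfCot
  refine div_le_div_of_nonneg_right ?_ (by norm_num)
  rw [div_le_div_iff₀ hb ha]
  linarith

theorem abs_halfCot_le {x Δ : ℝ} (hΔ : 0 < Δ) (h0 : Δ ≤ x) (h1 : x ≤ 1 - Δ) :
    |halfCot x| ≤ 1 / (4 * Δ) := by
  have hs := two_mul_le_sin_pi_mul hΔ h0 h1
  have hpos : 0 < Real.sin (Real.pi * x) := by linarith
  rw [halfCot, abs_div, abs_div, abs_of_pos hpos, abs_of_pos (two_pos : (0 : ℝ) < 2), div_div,
    div_le_div_iff₀ (by positivity) (by positivity)]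
  nlinarith [Real.abs_cos_le_one (Real.pi * x), abs_nonneg (Real.cos (Real.pi * x))]

theorem one_sub_e2pi_mul {x : ℝ} (h : Real.sin (Real.pi * x) ≠ 0) :
    (1 - e2pi x) * (1 / 2 + halfCot x * Complex.I) = 1 := by
  have he : e2pi x = ⟨Real.cos (2 * (Real.pi * x)), Real.sin (2 * (Real.pi * x))⟩ := by
    have : (2 * Real.pi * Complex.I * x : ℂ) = ((2 * (Real.pi * x) : ℝ) : ℂ) * Complex.I := by
      push_cast; ring
    rw [e2pi, this]
    apply Complex.ext
    · rw [Complex.exp_ofReal_mul_I_re]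
    · rw [Complex.exp_ofReal_mul_I_im]
  have hsq := Real.sin_sq_add_cos_sq (Real.pi * x)
  have hg : halfCot x * (2 * Real.sin (Real.pi * x)) = Real.cos (Real.pi * x) := by
    rw [halfCot]; field_simp
  have hsin : Real.sin (2 * (Real.pi * x)) * halfCot x = Real.cos (Real.pi * x) ^ 2 := by
    rw [Real.sin_two_mul, ← hg]; ring
  have hc : (1 / 2 + halfCot x * Complex.I : ℂ) = ⟨1 / 2, halfCot x⟩ := by
    apply Complex.ext <;> simp
  rw [he, hc]
  apply Complex.ext
  · simp only [Complex.mul_re, Complex.sub_re, Complex.sub_im, Complex.one_re, Complex.one_im]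
    rw [Real.cos_two_mul]
    linear_combination hsin
  · simp only [Complex.mul_im, Complex.sub_re, Complex.sub_im, Complex.one_re, Complex.one_im]
    rw [Real.cos_two_mul, Real.sin_two_mul]
    linear_combination Real.sin (Real.pi * x) * hg - 2 * halfCot x * hsq

theorem norm_half_add_halfCot_le {x Δ : ℝ} (hΔ : 0 < Δ) (h0 : Δ ≤ x) (h1 : x ≤ 1 - Δ) :
    ‖(1 / 2 + halfCot x * Complex.I : ℂ)‖ ≤ 1 / (4 * Δ) := by
  have hs := two_mul_le_sin_pi_mul hΔ h0 h1
  have hpos : 0 < Real.sin (Real.pi * x) := by linarith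
  have hsq := Real.sin_sq_add_cos_sq (Real.pi * x)
  have h2 : ‖(1 / 2 + halfCot x * Complex.I : ℂ)‖ ^ 2 = (1 / (2 * Real.sin (Real.pi * x))) ^ 2 := by
    have hc : (1 / 2 + halfCot x * Complex.I : ℂ) = ⟨1 / 2, halfCot x⟩ := by
      apply Complex.ext <;> simp
    rw [hc, Complex.sq_norm, Complex.normSq_mk, halfCot]
    field_simp
    linarith
  rw [(pow_left_inj₀ (norm_nonneg _) (by positivity) two_ne_zero).1 h2]
  exact one_div_le_one_div_of_le (by positivity) (by linarith)

/-- The Kusmin–Landau inequality, for difference sequences in a window inside `(0, 1)`. -/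
theorem kusmin_landau_aux (b : ℕ → ℝ) (N : ℕ) {Δ : ℝ} (hΔ : 0 < Δ)
    (hlo : ∀ n < N, Δ ≤ b (n + 1) - b n) (hhi : ∀ n < N, b (n + 1) - b n ≤ 1 - Δ)
    (hmono : ∀ n, n + 1 < N → b (n + 1) - b n ≤ b (n + 2) - b (n + 1)) :
    ‖∑ n ∈ range N, e2pi (b n)‖ ≤ 1 / Δ := by
  set c : ℕ → ℂ := fun n => 1 / 2 + halfCot (b (n + 1) - b n) * Complex.I with hc
  have hstep : ∀ n < N, e2pi (b n) = c n * (e2pi (b n) - e2pi (b (n + 1))) := by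
    intro n hn
    have hb : e2pi (b (n + 1)) = e2pi (b n) * e2pi (b (n + 1) - b n) := by
      rw [← e2pi_add]; ring_nf
    have h1 := one_sub_e2pi_mul (x := b (n + 1) - b n)
      (sin_pi_mul_pos (by linarith [hlo n hn]) (by linarith [hhi n hn])).ne'
    rw [hb]
    linear_combination (-e2pi (b n)) * h1
  have key : ∀ k < N, ‖∑ n ∈ range (k + 1), e2pi (b n) + c k * e2pi (b (k + 1))‖ ≤
      1 / (4 * Δ) + halfCot (b 1 - b 0) - halfCot (b (k + 1) - b k) := by
    intro k
    induction k with
    | zero =>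
      intro hk
      have h1 : ∑ n ∈ range (0 + 1), e2pi (b n) + c 0 * e2pi (b (0 + 1)) = c 0 * e2pi (b 0) := by
        rw [sum_range_one]
        linear_combination hstep 0 hk
      rw [h1, norm_mul, norm_e2pi]
      have := norm_half_add_halfCot_le hΔ (hlo 0 hk) (hhi 0 hk)
      simp only [zero_add, mul_one, hc] at this ⊢
      linarith
    | succ k ih =>
      intro hk
      have h1 : ∑ n ∈ range (k + 1 + 1), e2pi (b n) + c (k + 1) * e2pi (b (k + 1 + 1)) =
          (∑ n ∈ range (k + 1), e2pi (b n) + c k * e2pi (b (k + 1))) +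
            (c (k + 1) - c k) * e2pi (b (k + 1)) := by
        rw [sum_range_succ _ (k + 1)]
        linear_combination hstep (k + 1) hk
      have hanti := halfCot_anti (by linarith [hlo k (by omega)]) (hmono k hk)
        (by linarith [hhi (k + 1) hk])
      have h2 : ‖c (k + 1) - c k‖ =
          halfCot (b (k + 1) - b k) - halfCot (b (k + 1 + 1) - b (k + 1)) := by
        have : c (k + 1) - c k = -((halfCot (b (k + 1) - b k) -
            halfCot (b (k + 1 + 1) - b (k + 1)) : ℝ) : ℂ) * Complex.I := by
          simp only [hc]; push_cast; ring
        rw [this, norm_mul, norm_neg, Complex.norm_real, Complex.norm_I, mul_one,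
          Real.norm_of_nonneg (by linarith)]
      rw [h1]
      refine (norm_add_le _ _).trans ?_
      rw [norm_mul, norm_e2pi, mul_one, h2]
      linarith [ih (by omega)]
  rcases N with _ | k
  · simpa using hΔ.le
  · have h1 := key k (by omega)
    have h2 := norm_half_add_halfCot_le hΔ (hlo k (by omega)) (hhi k (by omega))
    have h3 := abs_le.1 (abs_halfCot_le hΔ (hlo 0 (by omega)) (hhi 0 (by omega)))
    have h4 := abs_le.1 (abs_halfCot_le hΔ (hlo k (by omega)) (hhi k (by omega)))
    have h5 : ∑ n ∈ range (k + 1), e2pi (b n) =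
        (∑ n ∈ range (k + 1), e2pi (b n) + c k * e2pi (b (k + 1))) - c k * e2pi (b (k + 1)) := by
      ring
    rw [h5]
    refine (norm_sub_le _ _).trans ?_
    rw [norm_mul, norm_e2pi, mul_one]
    have h6 : 1 / Δ = 4 * (1 / (4 * Δ)) := by field_simp
    simp only [zero_add] at h3
    simp only [hc] at h1 ⊢
    linarith

/-- The Kusmin–Landau inequality. -/
theorem kusmin_landau (b : ℕ → ℝ) (N : ℕ) (m : ℤ) {Δ : ℝ} (hΔ : 0 < Δ)
    (hlo : ∀ n < N, m + Δ ≤ b (n + 1) - b n) (hhi : ∀ n < N, b (n + 1) - b n ≤ m + 1 - Δ)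
    (hmono : ∀ n, n + 1 < N → b (n + 1) - b n ≤ b (n + 2) - b (n + 1)) :
    ‖∑ n ∈ range N, e2pi (b n)‖ ≤ 1 / Δ := by
  have h := kusmin_landau_aux (fun n => b n + ((-(m * n) : ℤ) : ℝ)) N hΔ
    (fun n hn => by have := hlo n hn; push_cast; linarith)
    (fun n hn => by have := hhi n hn; push_cast; linarith)
    (fun n hn => by have := hmono n hn; push_cast; linarith)
  simpa only [e2pi_add, e2pi_int, mul_one] using h

theorem exists_threshold (p : ℕ → Prop) (N : ℕ) (h : ∀ n, n + 1 < N → p (n + 1) → p n) :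
    ∃ k ≤ N, (∀ n < k, p n) ∧ ∀ n, k ≤ n → n < N → ¬ p n := by
  induction N with
  | zero => exact ⟨0, le_rfl, by simp, by simp⟩
  | succ N ih =>
    obtain ⟨k, hk, h1, h2⟩ := ih fun n hn => h n (by omega)
    by_cases hp : p N
    · refine ⟨N + 1, le_rfl, ?_, fun n h3 h4 => absurd h4 (by omega)⟩
      have : ∀ j, j ≤ N → p (N - j) := by
        intro j
        induction j with
        | zero => simpa using hp
        | succ j ihj =>
          intro hj
          refine h _ (by omega) ?_
          rw [show N - (j + 1) + 1 = N - j by omega]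
          exact ihj (by omega)
      intro n hn
      simpa [show N - (N - n) = n by omega] using this (N - n) (by omega)
    · refine ⟨k, by omega, h1, fun n h3 h4 => ?_⟩
      rcases Nat.lt_succ_iff_lt_or_eq.1 h4 with h5 | rfl
      · exact h2 n h3 h5
      · exact hp

theorem add_mul_le_of_step (D : ℕ → ℝ) (N : ℕ) (μ : ℝ)
    (h : ∀ n, n + 1 < N → D n + μ ≤ D (n + 1)) (i j : ℕ) (hj : i + j < N) :
    D i + j * μ ≤ D (i + j) := by
  induction j with
  | zero => simp
  | succ j ih =>
    have h1 := ih (by omega)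
    have h2 := h (i + j) (by omega)
    rw [← add_assoc]
    push_cast
    linarith

/-- The second derivative test, for a difference sequence varying by at most `1 / 2`. -/
theorem second_derivative_test (b : ℕ → ℝ) (N : ℕ) {μ : ℝ} (hμ : 0 < μ) (hμ1 : μ ≤ 1)
    (hstep : ∀ n, n + 1 < N → b (n + 1) - b n + μ ≤ b (n + 2) - b (n + 1))
    (hvar : ∀ n < N, b (n + 1) - b n ≤ b 1 - b 0 + 1 / 2) :
    ‖∑ n ∈ range N, e2pi (b n)‖ ≤ 10 / √μ := by
  set D : ℕ → ℝ := fun n => b (n + 1) - b n with hD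
  have hlin := add_mul_le_of_step D N μ hstep
  have hs : 0 < √μ := Real.sqrt_pos.2 hμ
  have hs1 : √μ ≤ 1 := Real.sqrt_le_one.2 hμ1
  have hsq : √μ * √μ = μ := Real.mul_self_sqrt hμ.le
  set m : ℤ := ⌊D 0 + 3 / 4⌋ with hm
  have hm1 : (m : ℝ) ≤ D 0 + 3 / 4 := Int.floor_le _
  have hm2 : D 0 + 3 / 4 < m + 1 := Int.lt_floor_add_one _
  set Δ : ℝ := √μ / 4 with hΔ
  have hΔ0 : 0 < Δ := by positivity
  have hDlo : ∀ n < N, (m : ℝ) - 3 / 4 ≤ D n := by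
    intro n hn
    have := hlin 0 n (by omega)
    have h2 : 0 ≤ n * μ := by positivity
    rw [zero_add] at this
    linarith
  have hDhi : ∀ n < N, D n ≤ m + 3 / 4 := by
    intro n hn
    have : D n ≤ D 0 + 1 / 2 := hvar n hn
    linarith
  have hanti : ∀ y : ℝ, ∀ n, n + 1 < N → D (n + 1) ≤ y → D n ≤ y := fun y n hn h => by
    have := hstep n hn
    simp only [hD] at *
    linarith
  obtain ⟨k₁, hk₁, h11, h12⟩ := exists_threshold (fun n => D n ≤ m - Δ) N (hanti _)
  obtain ⟨k₂, hk₂, h21, h22⟩ := exists_threshold (fun n => D n ≤ m + Δ) N (hanti _)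
  have h12k : k₁ ≤ k₂ := by
    by_contra hlt
    push Not at hlt
    have h3 := h11 k₂ hlt
    have h4 := h22 k₂ le_rfl (by omega)
    linarith
  have e1 : ‖∑ n ∈ range k₁, e2pi (b n)‖ ≤ 1 / Δ := by
    refine kusmin_landau b k₁ (m - 1) hΔ0 ?_ ?_ ?_
    · intro n hn
      have := hDlo n (by omega)
      simp only [hD] at this
      push_cast
      linarith
    · intro n hn
      have := h11 n hn
      simp only [hD] at this
      push_cast
      linarith
    · intro n hn
      linarith [hstep n (by omega)]
  have e3 : ‖∑ n ∈ Ico k₂ N, e2pi (b n)‖ ≤ 1 / Δ := by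
    rw [sum_Ico_eq_sum_range]
    refine kusmin_landau (fun n => b (k₂ + n)) (N - k₂) m hΔ0 ?_ ?_ ?_
    · intro n hn
      have := h22 (k₂ + n) (by omega) (by omega)
      simp only [hD] at this
      push Not at this
      exact this.le
    · intro n hn
      have := hDhi (k₂ + n) (by omega)
      simp only [hD] at this
      simp only [← add_assoc]
      linarith
    · intro n hn
      have := hstep (k₂ + n) (by omega)
      simp only [← add_assoc]
      linarith
  have e2 : ‖∑ n ∈ Ico k₁ k₂, e2pi (b n)‖ ≤ 1 / (2 * √μ) + 1 := by
    refine (norm_sum_e2pi_le _ _).trans ?_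
    rw [Nat.card_Ico]
    rcases Nat.eq_or_lt_of_le h12k with h | h
    · rw [h]; simp; positivity
    · have h3 := h12 k₁ le_rfl (by omega)
      have h4 := h21 (k₂ - 1) (by omega)
      have h5 := hlin k₁ (k₂ - 1 - k₁) (by omega)
      rw [show k₁ + (k₂ - 1 - k₁) = k₂ - 1 by omega] at h5
      push Not at h3
      have h6 : ((k₂ - k₁ : ℕ) : ℝ) = ((k₂ - 1 - k₁ : ℕ) : ℝ) + 1 := by
        rw [show k₂ - k₁ = (k₂ - 1 - k₁) + 1 by omega]; push_cast; ring
      rw [h6]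
      gcongr
      rw [le_div_iff₀ (by positivity)]
      have h7 : ((k₂ - 1 - k₁ : ℕ) : ℝ) * μ ≤ √μ / 2 := by
        have : √μ / 2 = 2 * Δ := by rw [hΔ]; ring
        linarith
      rw [← hsq] at h7
      have h8 : √μ * (((k₂ - 1 - k₁ : ℕ) : ℝ) * (2 * √μ)) ≤ √μ * 1 := by nlinarith
      exact le_of_mul_le_mul_left h8 hs
  have hsum : ∑ n ∈ range N, e2pi (b n) = ∑ n ∈ range k₁, e2pi (b n) +
      ∑ n ∈ Ico k₁ k₂, e2pi (b n) + ∑ n ∈ Ico k₂ N, e2pi (b n) := by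
    rw [range_eq_Ico, range_eq_Ico, sum_Ico_consecutive _ (Nat.zero_le _) h12k,
      sum_Ico_consecutive _ (Nat.zero_le _) hk₂]
  rw [hsum]
  refine (norm_add₃_le).trans ?_
  have h9 : 1 / Δ = 4 / √μ := by rw [hΔ]; field_simp
  have h10 : (1 : ℝ) ≤ 1 / √μ := by rw [le_div_iff₀ hs]; linarith
  have h11 : 1 / (2 * √μ) = (1 / 2) * (1 / √μ) := by field_simp
  have h12 : 10 / √μ = 10 * (1 / √μ) := by ring
  have h13 : 4 / √μ = 4 * (1 / √μ) := by ring
  rw [h9] at e1 e3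
  linarith

/-- The translate by `s` of the restriction of `z` to `[0, N)`, extended by zero. -/
noncomputable def shiftCut (z : ℕ → ℂ) (N s k : ℕ) : ℂ :=
  if s ≤ k ∧ k < N + s then z (k - s) else 0

theorem sum_shiftCut (z : ℕ → ℂ) {N s K : ℕ} (h : N + s ≤ K) :
    ∑ k ∈ range K, shiftCut z N s k = ∑ n ∈ range N, z n := by
  have hsub : Ico s (N + s) ⊆ range K := fun k hk => by
    rw [mem_Ico] at hk; rw [mem_range]; omega
  rw [← sum_subset hsub fun k _ hk => by
    rw [mem_Ico] at hk; rw [shiftCut, if_neg hk], sum_Ico_eq_sum_range, Nat.add_sub_cancel]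
  refine sum_congr rfl fun n hn => ?_
  rw [mem_range] at hn
  rw [shiftCut, if_pos (by omega), Nat.add_sub_cancel_left]

theorem sum_shiftCut_mul_conj (z : ℕ → ℂ) {N s t K : ℕ} (h : N + s ≤ K) :
    ∑ k ∈ range K, shiftCut z N s k * (starRingEnd ℂ) (shiftCut z N (s + t) k) =
      ∑ n ∈ range (N - t), z (n + t) * (starRingEnd ℂ) (z n) := by
  have hsub : Ico (s + t) (N + s) ⊆ range K := fun k hk => by
    rw [mem_Ico] at hk; rw [mem_range]; omega
  rw [← sum_subset hsub fun k _ hk => ?_, sum_Ico_eq_sum_range,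
    show N + s - (s + t) = N - t by omega]
  · refine sum_congr rfl fun n hn => ?_
    rw [mem_range] at hn
    rw [shiftCut, shiftCut, if_pos (by omega), if_pos (by omega), Nat.add_sub_cancel_left,
      show s + t + n - s = n + t by omega]
  · rw [mem_Ico] at hk
    by_cases h1 : s ≤ k ∧ k < N + s
    · rw [shiftCut, shiftCut, if_neg (by omega : ¬ (s + t ≤ k ∧ k < N + (s + t)))]
      simp
    · rw [shiftCut, if_neg h1, zero_mul]

/-- The norm of the autocorrelation of `z` on `[0, N)` at lag `t`. -/
noncomputable def corrNorm (z : ℕ → ℂ) (N t : ℕ) : ℝ :=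
  ‖∑ n ∈ range (N - t), z (n + t) * (starRingEnd ℂ) (z n)‖

theorem norm_sum_shiftCut_mul_conj (z : ℕ → ℂ) {N q i j K : ℕ} (hi : N + q * i ≤ K)
    (hj : N + q * j ≤ K) :
    ‖∑ k ∈ range K, shiftCut z N (q * i) k * (starRingEnd ℂ) (shiftCut z N (q * j) k)‖ =
      corrNorm z N (q * (i - j + (j - i))) := by
  rcases le_total i j with h | h
  · obtain ⟨t, rfl⟩ := Nat.exists_eq_add_of_le h
    rw [mul_add, sum_shiftCut_mul_conj z hi, corrNorm, show i - (i + t) + (i + t - i) = t by omega]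
  · obtain ⟨t, rfl⟩ := Nat.exists_eq_add_of_le h
    rw [← Complex.norm_conj, map_sum]
    simp only [map_mul, Complex.conj_conj]
    simp only [mul_comm ((starRingEnd ℂ) _)]
    rw [mul_add, sum_shiftCut_mul_conj z hj, corrNorm, show j + t - j + (j - (j + t)) = t by omega]

/-- The van der Corput inequality with shifts by multiples of `q`. -/
theorem van_der_corput (z : ℕ → ℂ) (hz : ∀ n, ‖z n‖ ≤ 1) (N q J : ℕ) (hJ : 1 ≤ J) {L : ℝ}
    (hN : (N : ℝ) ≤ L) (hq : (q * J : ℝ) ≤ L) :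
    ‖∑ n ∈ range N, z n‖ ^ 2 ≤
      2 * L / J * (L + 2 * ∑ j ∈ Ico 1 J, corrNorm z N (q * j)) := by
  set K := N + q * J with hK
  have hJ0 : (0 : ℝ) < J := by exact_mod_cast hJ
  have hKi : ∀ i < J, N + q * i ≤ K := fun i hi => by
    have := Nat.mul_le_mul_left q hi.le; omega
  have h1 : (J : ℂ) * ∑ n ∈ range N, z n =
      ∑ k ∈ range K, ∑ j ∈ range J, shiftCut z N (q * j) k := by
    rw [sum_comm, sum_congr rfl fun j hj => sum_shiftCut z (hKi j (mem_range.1 hj))]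
    simp
  have h2 : (J * ‖∑ n ∈ range N, z n‖) ^ 2 ≤
      K * ∑ k ∈ range K, ‖∑ j ∈ range J, shiftCut z N (q * j) k‖ ^ 2 := by
    have h3 : J * ‖∑ n ∈ range N, z n‖ ≤ ∑ k ∈ range K, ‖∑ j ∈ range J, shiftCut z N (q * j) k‖ := by
      rw [← Complex.norm_natCast, ← norm_mul, h1]
      exact norm_sum_le _ _
    calc _ ≤ (∑ k ∈ range K, ‖∑ j ∈ range J, shiftCut z N (q * j) k‖) ^ 2 := by gcongr
      _ ≤ _ := by simpa using sq_sum_le_card_mul_sum_sq (s := range K)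
                    (f := fun k => ‖∑ j ∈ range J, shiftCut z N (q * j) k‖)
  have h3 : ∑ k ∈ range K, ‖∑ j ∈ range J, shiftCut z N (q * j) k‖ ^ 2 ≤
      ∑ i ∈ range J, ∑ j ∈ range J, corrNorm z N (q * (i - j + (j - i))) := by
    have h4 : ((∑ k ∈ range K, ‖∑ j ∈ range J, shiftCut z N (q * j) k‖ ^ 2 : ℝ) : ℂ) =
        ∑ i ∈ range J, ∑ j ∈ range J, ∑ k ∈ range K,
          shiftCut z N (q * i) k * (starRingEnd ℂ) (shiftCut z N (q * j) k) := by
      push_cast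
      simp only [← Complex.mul_conj', map_sum, sum_mul_sum]
      rw [sum_comm]
      refine sum_congr rfl fun i _ => ?_
      rw [sum_comm]
    have h5 : ∑ k ∈ range K, ‖∑ j ∈ range J, shiftCut z N (q * j) k‖ ^ 2 =
        ‖((∑ k ∈ range K, ‖∑ j ∈ range J, shiftCut z N (q * j) k‖ ^ 2 : ℝ) : ℂ)‖ := by
      rw [Complex.norm_real, Real.norm_of_nonneg (by positivity)]
    rw [h5, h4]
    refine (norm_sum_le _ _).trans (sum_le_sum fun i hi => ?_)
    refine (norm_sum_le _ _).trans (sum_le_sum fun j hj => ?_)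
    rw [norm_sum_shiftCut_mul_conj z (hKi i (mem_range.1 hi)) (hKi j (mem_range.1 hj))]
  have hc0 : ∀ t, 0 ≤ corrNorm z N t := fun t => norm_nonneg _
  have h4 : ∀ i ∈ range J, ∑ j ∈ range J, corrNorm z N (q * (i - j + (j - i))) ≤
      L + 2 * ∑ j ∈ Ico 1 J, corrNorm z N (q * j) := by
    intro i hi
    rw [mem_range] at hi
    have hs : ∑ j ∈ range J, corrNorm z N (q * (i - j + (j - i))) =
        ∑ j ∈ range i, corrNorm z N (q * (i - j + (j - i))) + (corrNorm z N 0 +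
        ∑ j ∈ Ico (i + 1) J, corrNorm z N (q * (i - j + (j - i)))) := by
      rw [range_eq_Ico, range_eq_Ico, ← sum_Ico_consecutive _ (Nat.zero_le i) hi.le,
        sum_eq_sum_Ico_succ_bot hi]
      simp
    have ha : ∑ j ∈ range i, corrNorm z N (q * (i - j + (j - i))) ≤
        ∑ j ∈ Ico 1 J, corrNorm z N (q * j) := by
      have : ∑ j ∈ range i, corrNorm z N (q * (i - j + (j - i))) =
          ∑ j ∈ Ico 1 (i + 1), corrNorm z N (q * j) := by
        refine sum_bij' (fun j _ => i - j) (fun j _ => i - j) ?_ ?_ ?_ ?_ ?_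
        · intro j hj; rw [mem_range] at hj; rw [mem_Ico]; omega
        · intro j hj; rw [mem_Ico] at hj; rw [mem_range]; omega
        · intro j hj; rw [mem_range] at hj; omega
        · intro j hj; rw [mem_Ico] at hj; omega
        · intro j hj
          rw [mem_range] at hj
          rw [show i - j + (j - i) = i - j by omega]
      rw [this]
      exact sum_le_sum_of_subset_of_nonneg (Ico_subset_Ico_right hi) fun t _ _ => hc0 _
    have hb : ∑ j ∈ Ico (i + 1) J, corrNorm z N (q * (i - j + (j - i))) ≤
        ∑ j ∈ Ico 1 J, corrNorm z N (q * j) := by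
      have : ∑ j ∈ Ico (i + 1) J, corrNorm z N (q * (i - j + (j - i))) =
          ∑ j ∈ Ico 1 (J - i), corrNorm z N (q * j) := by
        refine sum_bij' (fun j _ => j - i) (fun j _ => j + i) ?_ ?_ ?_ ?_ ?_
        · intro j hj; rw [mem_Ico] at hj ⊢; omega
        · intro j hj; rw [mem_Ico] at hj ⊢; omega
        · intro j hj; rw [mem_Ico] at hj; omega
        · intro j hj; rw [mem_Ico] at hj; omega
        · intro j hj
          rw [mem_Ico] at hj
          rw [show i - j + (j - i) = j - i by omega]
      rw [this]
      exact sum_le_sum_of_subset_of_nonneg (Ico_subset_Ico_right (Nat.sub_le _ _))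
        fun t _ _ => hc0 _
    have h0 : corrNorm z N 0 ≤ L := by
      refine le_trans ?_ hN
      refine (norm_sum_le _ _).trans ?_
      calc _ ≤ ∑ n ∈ range (N - 0), (1 : ℝ) := sum_le_sum fun n _ => by
            rw [norm_mul, Complex.norm_conj]
            exact mul_le_one₀ (hz _) (norm_nonneg _) (hz _)
        _ = N := by simp
    linarith
  have hKL : (K : ℝ) ≤ 2 * L := by rw [hK]; push_cast; linarith
  have h5 : (J * ‖∑ n ∈ range N, z n‖) ^ 2 ≤
      2 * L * (J * (L + 2 * ∑ j ∈ Ico 1 J, corrNorm z N (q * j))) := by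
    refine h2.trans ?_
    refine mul_le_mul hKL ?_ (by positivity) ((Nat.cast_nonneg _).trans hKL)
    refine h3.trans ((sum_le_sum h4).trans ?_)
    rw [sum_const, card_range, nsmul_eq_mul]
  have h6 : 2 * L / J * (L + 2 * ∑ j ∈ Ico 1 J, corrNorm z N (q * j)) =
      2 * L * (J * (L + 2 * ∑ j ∈ Ico 1 J, corrNorm z N (q * j))) / (J : ℝ) ^ 2 := by
    field_simp
  rw [h6, le_div_iff₀ (by positivity)]
  linarith [mul_pow (J : ℝ) ‖∑ n ∈ range N, z n‖ 2]

theorem corrNorm_e2pi (f : ℕ → ℝ) (N t : ℕ) :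
    corrNorm (fun n => e2pi (f n)) N t = ‖∑ n ∈ range (N - t), e2pi (f (n + t) - f n)‖ := by
  simp only [corrNorm, conj_e2pi, ← e2pi_add, ← sub_eq_add_neg]

/-- The second difference of a sequence. -/
def secondDiff (f : ℕ → ℝ) (n : ℕ) : ℝ := f (n + 2) - 2 * f (n + 1) + f n

theorem shift_diff_eq_sum_secondDiff (f : ℕ → ℝ) (t n : ℕ) :
    (f (n + 1 + t) - f (n + 1)) - (f (n + t) - f n) = ∑ i ∈ range t, secondDiff f (n + i) := by
  induction t with
  | zero => simp
  | succ t ih =>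
    rw [sum_range_succ, ← ih, secondDiff, show n + 1 + (t + 1) = n + t + 2 by ring,
      show n + 1 + t = n + t + 1 by ring, show n + (t + 1) = n + t + 1 by ring]
    ring

theorem shift_diff_step (f : ℕ → ℝ) (t n : ℕ) :
    ((f (n + 2 + t) - f (n + 2)) - (f (n + 1 + t) - f (n + 1))) -
      ((f (n + 1 + t) - f (n + 1)) - (f (n + t) - f n)) =
      ∑ i ∈ range t, (secondDiff f (n + i + 1) - secondDiff f (n + i)) := by
  have h := shift_diff_eq_sum_secondDiff f t (n + 1)
  rw [sum_sub_distrib, ← shift_diff_eq_sum_secondDiff]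
  simp only [add_right_comm n _ 1]
  rw [← h]

/-- Bound for the correlation sum at lag `t`, from the second derivative test. -/
theorem norm_corr_le_of_thirdDiff (f : ℕ → ℝ) (M : ℕ) {lam C : ℝ} (hlam : 0 < lam)
    (h1 : ∀ n < M, lam ≤ secondDiff f (n + 1) - secondDiff f n)
    (h2 : ∀ n < M, secondDiff f (n + 1) - secondDiff f n ≤ C * lam)
    (t : ℕ) (ht : 1 ≤ t) (ht1 : t * lam ≤ 1) (ht2 : C * t * lam * M ≤ 1 / 2) :
    ‖∑ n ∈ range (M - t), e2pi (f (n + t) - f n)‖ ≤ 10 / √(t * lam) := by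
  have ht0 : (0 : ℝ) < t := by exact_mod_cast ht
  have hup : ∀ n < M - t, (f (n + 2 + t) - f (n + 2)) - (f (n + 1 + t) - f (n + 1)) -
      ((f (n + 1 + t) - f (n + 1)) - (f (n + t) - f n)) ≤ t * (C * lam) := fun n hn => by
    rw [shift_diff_step]
    calc _ ≤ ∑ i ∈ range t, C * lam := sum_le_sum fun i hi => h2 _ (by
          rw [mem_range] at hi; omega)
      _ = _ := by simp
  refine second_derivative_test (fun n => f (n + t) - f n) (M - t) (by positivity) ht1 ?_ ?_
  · intro n hn
    have : (t : ℝ) * lam ≤ ∑ i ∈ range t, (secondDiff f (n + i + 1) - secondDiff f (n + i)) := by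
      calc _ = ∑ i ∈ range t, lam := by simp
        _ ≤ _ := sum_le_sum fun i hi => h1 _ (by rw [mem_range] at hi; omega)
    rw [← shift_diff_step] at this
    linarith
  · intro n hn
    have key : ∀ k, k < M - t → (f (k + 1 + t) - f (k + 1)) - (f (k + t) - f k) ≤
        (f (0 + 1 + t) - f (0 + 1)) - (f (0 + t) - f 0) + k * (t * (C * lam)) := by
      intro k
      induction k with
      | zero => intro _; simp
      | succ k ih =>
        intro hk
        have h3 := ih (by omega)
        have h4 := hup k (by omega)
        push_cast
        rw [show k + 1 + 1 = k + 2 by ring]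
        linarith
    have h3 := key n hn
    have hC : 0 ≤ C * lam := hlam.le.trans ((h1 n (by omega)).trans (h2 n (by omega)))
    have h4 : (n : ℝ) * (t * (C * lam)) ≤ M * (t * (C * lam)) := by
      have : (n : ℝ) ≤ M := by exact_mod_cast (by omega : n ≤ M)
      gcongr
    have h5 : (M : ℝ) * (t * (C * lam)) = C * t * lam * M := by ring
    simp only [zero_add] at h3 ⊢
    linarith

theorem sum_rpow_neg_three_quarters_le (J : ℕ) :
    ∑ j ∈ Ico 1 J, (j : ℝ) ^ (-(3 / 4) : ℝ) ≤ 4 * (J : ℝ) ^ (1 / 4 : ℝ) := by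
  have key : ∑ j ∈ Ico 1 (J + 1), (j : ℝ) ^ (-(3 / 4) : ℝ) ≤ 4 * (J : ℝ) ^ (1 / 4 : ℝ) := by
    induction J with
    | zero => simp
    | succ J ih =>
      rw [sum_Ico_succ_top (by omega)]
      set v : ℝ := (J : ℝ) ^ (1 / 4 : ℝ) with hv
      set u : ℝ := ((J + 1 : ℕ) : ℝ) ^ (1 / 4 : ℝ) with hu
      have hv0 : 0 ≤ v := by positivity
      have hu0 : 0 < u := by positivity
      have hvu : v ≤ u := by
        rw [hu, hv]; gcongr; omega
      have hu4 : u ^ 4 = J + 1 := by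
        rw [hu, ← Real.rpow_natCast, ← Real.rpow_mul (by positivity)]; norm_num
      have hv4 : v ^ 4 = J := by
        rw [hv, ← Real.rpow_natCast, ← Real.rpow_mul (by positivity)]; norm_num
      have hu3 : ((J + 1 : ℕ) : ℝ) ^ (-(3 / 4) : ℝ) = 1 / u ^ 3 := by
        rw [Real.rpow_neg (by positivity), hu, ← Real.rpow_natCast, ← Real.rpow_mul (by positivity)]
        norm_num
      have h1 : 1 / u ^ 3 ≤ 4 * (u - v) := by
        rw [div_le_iff₀ (by positivity)]
        have h2 : v * u ^ 2 ≤ u ^ 3 := by nlinarith [mul_nonneg (sub_nonneg.2 hvu) (sq_nonneg u)]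
        have h3 : v ^ 2 * u ≤ u ^ 3 := by
          nlinarith [mul_nonneg (sub_nonneg.2 hvu) (mul_nonneg hv0 hu0.le)]
        have h4 : v ^ 3 ≤ u ^ 3 := by gcongr
        nlinarith [mul_nonneg (sub_nonneg.2 hvu) (add_nonneg (add_nonneg (sub_nonneg.2 h2)
          (sub_nonneg.2 h3)) (sub_nonneg.2 h4))]
      rw [hu3]
      linarith
  exact (sum_le_sum_of_subset_of_nonneg (Ico_subset_Ico_right (by omega))
    fun _ _ _ => by positivity).trans key

theorem min_le_mul_rpow {L x S : ℝ} (hL : 0 ≤ L) (hx : 0 < x) (h1 : S ≤ L) (h2 : S ≤ L / x) :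
    S ≤ L * x ^ (-(3 / 4) : ℝ) := by
  rcases le_total x 1 with h | h
  · refine h1.trans (le_mul_of_one_le_right hL ?_)
    exact Real.one_le_rpow_of_pos_of_le_one_of_nonpos hx h (by norm_num)
  · refine h2.trans ?_
    rw [div_eq_mul_inv]
    gcongr
    rw [← Real.rpow_neg_one]
    exact Real.rpow_le_rpow_of_exponent_le h (by norm_num)

theorem norm_sum_e2pi_neg (f : ℕ → ℝ) (s : Finset ℕ) :
    ‖∑ n ∈ s, e2pi (-f n)‖ = ‖∑ n ∈ s, e2pi (f n)‖ := by
  simp only [← conj_e2pi, ← map_sum, Complex.norm_conj]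

/-- Bound for a sum on which the second difference stays close to, but away from, `a / q`. -/
theorem norm_sum_sq_le_of_secondDiff_near (f : ℕ → ℝ) (N q J : ℕ) (a : ℤ) {σ δ δ' L : ℝ}
    (hσ : σ = 1 ∨ σ = -1) (hq : 1 ≤ q) (hJ : 1 ≤ J) (hN : (N : ℝ) ≤ L) (hqJ : (q * J : ℝ) ≤ L)
    (hδ : 0 < δ) (hδ' : J * δ' ≤ 1 / 2)
    (hlo : ∀ n < N, δ ≤ σ * (q * secondDiff f n - a))
    (hhi : ∀ n < N, σ * (q * secondDiff f n - a) ≤ δ')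
    (hmono : ∀ n, n + 1 < N → secondDiff f n ≤ secondDiff f (n + 1)) :
    ‖∑ n ∈ range N, e2pi (f n)‖ ^ 2 ≤
      2 * L ^ 2 / J + 16 * L ^ 2 * (J * δ * L) ^ (-(3 / 4) : ℝ) := by
  have hJ0 : (0 : ℝ) < J := by exact_mod_cast hJ
  have hq0 : (0 : ℝ) < q := by exact_mod_cast hq
  have hL : 0 < L := lt_of_lt_of_le (by positivity) hqJ
  refine (van_der_corput (fun n => e2pi (f n)) (fun n => (norm_e2pi _).le) N q J hJ hN hqJ).trans ?_
  have hterm : ∀ j ∈ Ico 1 J, corrNorm (fun n => e2pi (f n)) N (q * j) ≤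
      L * (δ * L) ^ (-(3 / 4) : ℝ) * (j : ℝ) ^ (-(3 / 4) : ℝ) := by
    intro j hj
    rw [mem_Ico] at hj
    have hj0 : (0 : ℝ) < j := by exact_mod_cast hj.1
    rw [mul_assoc, ← Real.mul_rpow (by positivity) (by positivity), corrNorm_e2pi]
    refine min_le_mul_rpow hL.le (by positivity) ?_ ?_
    · refine (norm_sum_e2pi_le _ _).trans (le_trans ?_ hN)
      rw [card_range]
      exact_mod_cast Nat.sub_le _ _
    · have h1 : L / (δ * L * j) = 1 / (j * δ) := by field_simp
      rw [h1]
      have hD : ∀ n < N - q * j, j * δ ≤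
          σ * ((f (n + 1 + q * j) - f (n + 1)) - (f (n + q * j) - f n) - (j * a : ℤ)) ∧
          σ * ((f (n + 1 + q * j) - f (n + 1)) - (f (n + q * j) - f n) - (j * a : ℤ)) ≤ 1 / 2 := by
        intro n hn
        have hsum : q * (σ * ((f (n + 1 + q * j) - f (n + 1)) - (f (n + q * j) - f n) -
            (j * a : ℤ))) =
            ∑ i ∈ range (q * j), σ * (q * secondDiff f (n + i) - a) := by
          rw [shift_diff_eq_sum_secondDiff, ← mul_sum, sum_sub_distrib, ← mul_sum]
          simp
          ring
        have hlo' : q * (j * δ) ≤ ∑ i ∈ range (q * j), σ * (q * secondDiff f (n + i) - a) := by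
          calc _ = ∑ i ∈ range (q * j), δ := by simp; ring
            _ ≤ _ := sum_le_sum fun i hi => hlo _ (by rw [mem_range] at hi; omega)
        have hhi' : ∑ i ∈ range (q * j), σ * (q * secondDiff f (n + i) - a) ≤ q * (j * δ') := by
          calc _ ≤ ∑ i ∈ range (q * j), δ' :=
                sum_le_sum fun i hi => hhi _ (by rw [mem_range] at hi; omega)
            _ = _ := by simp; ring
        rw [← hsum] at hlo' hhi'
        refine ⟨le_of_mul_le_mul_left hlo' hq0, (le_of_mul_le_mul_left hhi' hq0).trans ?_⟩
        have hδδ : 0 ≤ δ' := hδ.le.trans ((hlo n (by omega)).trans (hhi n (by omega)))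
        have : (j : ℝ) ≤ J := by exact_mod_cast hj.2.le
        exact (mul_le_mul_of_nonneg_right this hδδ).trans hδ'
      have hDm : ∀ n, n + 1 < N - q * j → (f (n + 1 + q * j) - f (n + 1)) - (f (n + q * j) - f n) ≤
          (f (n + 2 + q * j) - f (n + 2)) - (f (n + 1 + q * j) - f (n + 1)) := by
        intro n hn
        rw [← sub_nonneg, shift_diff_step]
        refine sum_nonneg fun i hi => sub_nonneg.2 (hmono _ ?_)
        rw [mem_range] at hi
        omega
      by_cases hjδ : N - q * j = 0
      · rw [hjδ]; simp; positivity
      have hjδ' : j * δ ≤ 1 / 2 := (hD 0 (by omega)).1.trans (hD 0 (by omega)).2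
      rcases hσ with rfl | rfl
      · refine kusmin_landau (fun n => f (n + q * j) - f n) _ (j * a) (by positivity) ?_ ?_ hDm
        · intro n hn
          linarith [(hD n hn).1]
        · intro n hn
          linarith [(hD n hn).2]
      · refine kusmin_landau (fun n => f (n + q * j) - f n) _ (j * a - 1) (by positivity) ?_ ?_ hDm
        · intro n hn
          have := (hD n hn).2
          push_cast at this ⊢
          linarith
        · intro n hn
          have := (hD n hn).1
          push_cast at this ⊢
          linarith
  have hsum : ∑ j ∈ Ico 1 J, corrNorm (fun n => e2pi (f n)) N (q * j) ≤
      L * (δ * L) ^ (-(3 / 4) : ℝ) * (4 * (J : ℝ) ^ (1 / 4 : ℝ)) := by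
    refine (sum_le_sum hterm).trans ?_
    rw [← mul_sum]
    exact mul_le_mul_of_nonneg_left (sum_rpow_neg_three_quarters_le J) (by positivity)
  have hJJ : (J : ℝ) ^ (1 / 4 : ℝ) = J * (J : ℝ) ^ (-(3 / 4) : ℝ) := by
    rw [← Real.rpow_one_add' (by positivity) (by norm_num)]; norm_num
  calc 2 * L / J * (L + 2 * ∑ j ∈ Ico 1 J, corrNorm (fun n => e2pi (f n)) N (q * j))
      ≤ 2 * L / J * (L + 2 * (L * (δ * L) ^ (-(3 / 4) : ℝ) * (4 * (J : ℝ) ^ (1 / 4 : ℝ)))) := by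
        gcongr
    _ = _ := by
        rw [hJJ, mul_assoc (J : ℝ) δ L, Real.mul_rpow (y := δ * L) hJ0.le (by positivity)]
        field_simp
        ring

theorem exists_filter_eq_Ico (g : ℕ → ℝ) (M : ℕ)
    (hg : (∀ n, n + 1 < M → g n ≤ g (n + 1)) ∨ (∀ n, n + 1 < M → g (n + 1) ≤ g n)) (u v : ℝ) :
    ∃ k₁ k₂, k₂ ≤ M ∧ {n ∈ range M | u ≤ g n ∧ g n < v} = Ico k₁ k₂ := by
  rcases hg with hg | hg
  · obtain ⟨k₁, hk₁, h11, h12⟩ := exists_threshold (fun n => g n < u) M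
      (fun n hn h => (hg n hn).trans_lt h)
    obtain ⟨k₂, hk₂, h21, h22⟩ := exists_threshold (fun n => g n < v) M
      (fun n hn h => (hg n hn).trans_lt h)
    refine ⟨k₁, k₂, hk₂, ?_⟩
    ext n
    simp only [mem_filter, mem_range, mem_Ico]
    constructor
    · rintro ⟨h1, h2, h3⟩
      refine ⟨?_, ?_⟩
      · by_contra h; exact absurd (h11 n (by omega)) (not_lt.2 h2)
      · by_contra h; exact h22 n (by omega) h1 h3
    · rintro ⟨h1, h2⟩
      exact ⟨by omega, not_lt.1 (h12 n h1 (by omega)), h21 n h2⟩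
  · obtain ⟨k₁, hk₁, h11, h12⟩ := exists_threshold (fun n => v ≤ g n) M
      (fun n hn h => h.trans (hg n hn))
    obtain ⟨k₂, hk₂, h21, h22⟩ := exists_threshold (fun n => u ≤ g n) M
      (fun n hn h => h.trans (hg n hn))
    refine ⟨k₁, k₂, hk₂, ?_⟩
    ext n
    simp only [mem_filter, mem_range, mem_Ico]
    constructor
    · rintro ⟨h1, h2, h3⟩
      refine ⟨?_, ?_⟩
      · by_contra h; exact absurd (h11 n (by omega)) (not_le.2 h3)
      · by_contra h; exact h22 n (by omega) h1 h2
    · rintro ⟨h1, h2⟩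
      exact ⟨by omega, h21 n h2, not_le.1 (h12 n h1 (by omega))⟩

/-- `norm_sum_sq_le_of_secondDiff_near` on the set where the distance of the second difference
from `a / q` lies in a given range. -/
theorem norm_sum_filter_sq_le (f : ℕ → ℝ) (M q J : ℕ) (a : ℤ) {σ δ v δ' L : ℝ}
    (hσ : σ = 1 ∨ σ = -1) (hq : 1 ≤ q) (hJ : 1 ≤ J) (u : ℝ)
    (hN : (#{n ∈ range M | u ≤ σ * (q * secondDiff f n - a) ∧
      σ * (q * secondDiff f n - a) < v} : ℝ) ≤ L)
    (hqJ : (q * J : ℝ) ≤ L) (hδ : 0 < δ) (hδ' : J * δ' ≤ 1 / 2)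
    (hlo : ∀ n < M, u ≤ σ * (q * secondDiff f n - a) → σ * (q * secondDiff f n - a) < v →
      δ ≤ σ * (q * secondDiff f n - a))
    (hhi : ∀ n < M, u ≤ σ * (q * secondDiff f n - a) → σ * (q * secondDiff f n - a) < v →
      σ * (q * secondDiff f n - a) ≤ δ')
    (hmono : ∀ n < M, secondDiff f n ≤ secondDiff f (n + 1)) :
    ‖∑ n ∈ range M with u ≤ σ * (q * secondDiff f n - a) ∧ σ * (q * secondDiff f n - a) < v,
      e2pi (f n)‖ ^ 2 ≤ 2 * L ^ 2 / J + 16 * L ^ 2 * (J * δ * L) ^ (-(3 / 4) : ℝ) := by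
  obtain ⟨k₁, k₂, hk₂, hk⟩ := exists_filter_eq_Ico (fun n => σ * (q * secondDiff f n - a)) M (by
    rcases hσ with rfl | rfl
    · left; intro n hn
      have := mul_le_mul_of_nonneg_left (hmono n (by omega)) (Nat.cast_nonneg (α := ℝ) q)
      linarith
    · right; intro n hn
      have := mul_le_mul_of_nonneg_left (hmono n (by omega)) (Nat.cast_nonneg (α := ℝ) q)
      linarith) u v
  have hmem : ∀ n, n < k₂ - k₁ → u ≤ σ * (q * secondDiff f (k₁ + n) - a) ∧
      σ * (q * secondDiff f (k₁ + n) - a) < v := fun n hn => by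
    have : k₁ + n ∈ Ico k₁ k₂ := by rw [mem_Ico]; omega
    rw [← hk, mem_filter] at this
    exact this.2
  rw [hk, Nat.card_Ico] at hN
  rw [hk, sum_Ico_eq_sum_range]
  refine norm_sum_sq_le_of_secondDiff_near (fun n => f (k₁ + n)) (k₂ - k₁) q J a hσ hq hJ hN hqJ hδ
    hδ' (fun n hn => hlo (k₁ + n) (by omega) (hmem n hn).1 (hmem n hn).2)
    (fun n hn => hhi (k₁ + n) (by omega) (hmem n hn).1 (hmem n hn).2)
    fun n hn => hmono (k₁ + n) (by omega)

theorem secondDiff_bounds {f : ℕ → ℝ} {M : ℕ} {lam C : ℝ} (hlam : 0 ≤ lam)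
    (h1 : ∀ n < M, lam ≤ secondDiff f (n + 1) - secondDiff f n)
    (h2 : ∀ n < M, secondDiff f (n + 1) - secondDiff f n ≤ C * lam) :
    ∀ n < M, secondDiff f 0 ≤ secondDiff f n ∧
      secondDiff f n ≤ secondDiff f 0 + n * (C * lam) := by
  intro n
  induction n with
  | zero => intro _; simp
  | succ n ih =>
    intro hn
    have h3 := ih (by omega)
    have h4 := h1 n (by omega)
    have h5 := h2 n (by omega)
    push_cast
    constructor <;> linarith

theorem card_filter_le_of_step (g : ℕ → ℝ) (M : ℕ) {σ μ : ℝ} (hσ : σ = 1 ∨ σ = -1) (hμ : 0 < μ)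
    (hg : ∀ n < M, g n + μ ≤ g (n + 1)) {u v T : ℝ} (hT : 0 ≤ T) (huv : v - u ≤ T * μ) :
    (#{n ∈ range M | u ≤ σ * g n ∧ σ * g n < v} : ℝ) ≤ T + 1 := by
  obtain ⟨k₁, k₂, hk₂, hk⟩ := exists_filter_eq_Ico (fun n => σ * g n) M (by
    rcases hσ with rfl | rfl
    · left; intro n hn; linarith [hg n (by omega)]
    · right; intro n hn; linarith [hg n (by omega)]) u v
  rw [hk, Nat.card_Ico]
  rcases Nat.lt_or_ge k₁ k₂ with h | h
  · have hm1 : k₁ ∈ Ico k₁ k₂ := by rw [mem_Ico]; omega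
    have hm2 : k₂ - 1 ∈ Ico k₁ k₂ := by rw [mem_Ico]; omega
    rw [← hk, mem_filter] at hm1 hm2
    have h5 := add_mul_le_of_step g M μ (fun n hn => hg n (by omega)) k₁ (k₂ - 1 - k₁) (by omega)
    rw [show k₁ + (k₂ - 1 - k₁) = k₂ - 1 by omega] at h5
    have h6 : ((k₂ - k₁ : ℕ) : ℝ) = ((k₂ - 1 - k₁ : ℕ) : ℝ) + 1 := by
      rw [show k₂ - k₁ = (k₂ - 1 - k₁) + 1 by omega]; push_cast; ring
    rw [h6]
    have h7 : ((k₂ - 1 - k₁ : ℕ) : ℝ) * μ ≤ T * μ := by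
      rcases hσ with rfl | rfl <;> linarith [hm1.2.1, hm1.2.2, hm2.2.1, hm2.2.2]
    linarith [le_of_mul_le_mul_right h7 hμ]
  · rw [Nat.sub_eq_zero_of_le h]
    simp; linarith

theorem le_add_of_sq_le_add_sq {x A B : ℝ} (hA : 0 ≤ A) (hB : 0 ≤ B)
    (h : x ^ 2 ≤ A ^ 2 + B ^ 2) : x ≤ A + B :=
  (abs_le_of_sq_le_sq' (by nlinarith [mul_nonneg hA hB]) (by positivity)).2

/-- The ratio governing the decay of the dyadic pieces near a rational with small denominator. -/
noncomputable def dyadicRatio : ℝ := √(4 * (8 : ℝ) ^ (-(3 / 4) : ℝ))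

theorem dyadicRatio_nonneg : 0 ≤ dyadicRatio := Real.sqrt_nonneg _

theorem dyadicRatio_lt_one : dyadicRatio < 1 := by
  rw [dyadicRatio, Real.sqrt_lt' one_pos, one_pow]
  have h1 : ((8 : ℝ) ^ (-(3 / 4) : ℝ)) ^ 4 = 1 / 512 := by
    rw [← Real.rpow_natCast, ← Real.rpow_mul (by norm_num)]
    norm_num
  by_contra h
  push Not at h
  have h2 : (1 / 4 : ℝ) ^ 4 ≤ ((8 : ℝ) ^ (-(3 / 4) : ℝ)) ^ 4 := by
    gcongr
    linarith
  rw [h1] at h2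
  norm_num at h2

section NearRational

variable {f : ℕ → ℝ} {M q : ℕ} {a : ℤ} {P : ℝ}

theorem step_mul_secondDiff
    (h1 : ∀ n < M, 1 / P ^ 6 ≤ secondDiff f (n + 1) - secondDiff f n) :
    ∀ n < M, (q * secondDiff f n - a) + q / P ^ 6 ≤ q * secondDiff f (n + 1) - a := by
  intro n hn
  have := mul_le_mul_of_nonneg_left (h1 n hn) (Nat.cast_nonneg (α := ℝ) q)
  rw [mul_one_div] at this
  linarith

theorem norm_dyadic_piece_le {σ : ℝ} (hσ : σ = 1 ∨ σ = -1) (hP : 1000 ≤ P)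
    (h1 : ∀ n < M, 1 / P ^ 6 ≤ secondDiff f (n + 1) - secondDiff f n)
    (hq : 1 ≤ q) (hqP : (q : ℝ) ≤ P) (i : ℕ) (hi : (2 : ℝ) ^ i ≤ P) :
    ‖∑ n ∈ range M with 2 ^ i * (q / P ^ 4) ≤ σ * (q * secondDiff f n - a) ∧
      σ * (q * secondDiff f n - a) < 2 ^ (i + 1) * (q / P ^ 4), e2pi (f n)‖ ≤
      8 * √2 ^ i * √(P ^ 3) + 16 * P ^ 2 * dyadicRatio ^ i := by
  have hP0 : 0 < P := by linarith
  have hq0 : (0 : ℝ) < q := by exact_mod_cast hq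
  have hi1 : (1 : ℝ) ≤ 2 ^ i := one_le_pow₀ (by norm_num)
  set t : ℝ := 2 ^ i * P ^ 2 with ht
  have ht0 : 0 < t := by positivity
  have htP : P ^ 2 ≤ t := by nlinarith [sq_nonneg P]
  have ht3 : t ≤ P ^ 3 := by rw [ht]; nlinarith [sq_nonneg P]
  have hY : 2 ^ i * (q / P ^ 4) = t * (q / P ^ 6) := by rw [ht]; field_simp
  have hY2 : 2 ^ (i + 1) * (q / P ^ 4) = 2 * t * (q / P ^ 6) := by
    rw [ht, pow_succ]; field_simp
  rw [hY, hY2]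
  set J : ℕ := ⌊t / (4 * q)⌋₊ with hJ
  have htq : 2 ≤ t / (4 * q) := by
    rw [le_div_iff₀ (by positivity)]; nlinarith
  have hJle : (J : ℝ) ≤ t / (4 * q) := Nat.floor_le (by positivity)
  have hJge : t / (8 * q) ≤ J := by
    have h3 : t / (4 * q) < J + 1 := Nat.lt_floor_add_one _
    have h4 : t / (8 * q) = t / (4 * q) / 2 := by field_simp; norm_num
    rw [h4]; linarith
  have hJ1 : 1 ≤ J := Nat.le_floor (by push_cast; linarith)
  have hJ0 : (0 : ℝ) < J := by exact_mod_cast hJ1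
  have hqJ : (q * J : ℝ) ≤ 2 * t := by
    calc (q * J : ℝ) ≤ q * (t / (4 * q)) := by gcongr
      _ = t / 4 := by field_simp
      _ ≤ 2 * t := by linarith
  have hstep := step_mul_secondDiff (q := q) (a := a) h1
  have hcard := card_filter_le_of_step (fun n => q * secondDiff f n - a) M hσ
    (μ := q / P ^ 6) (by positivity) hstep (u := t * (q / P ^ 6)) (v := 2 * t * (q / P ^ 6)) ht0.le
    (by linarith)
  have key := norm_sum_filter_sq_le f M q J a (δ := t * (q / P ^ 6)) (v := 2 * t * (q / P ^ 6))
    (δ' := 2 * t * (q / P ^ 6)) (L := 2 * t) hσ hq hJ1 (t * (q / P ^ 6))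
    (hcard.trans (by nlinarith)) hqJ (by positivity) (by
      calc J * (2 * t * (q / P ^ 6)) ≤ t / (4 * q) * (2 * t * (q / P ^ 6)) := by gcongr
        _ = (1 / 2) * (t ^ 2 / P ^ 6) := by field_simp; norm_num
        _ ≤ (1 / 2) * 1 := by
          gcongr
          rw [div_le_one (by positivity)]
          calc t ^ 2 ≤ (P ^ 3) ^ 2 := by gcongr
            _ = P ^ 6 := by ring
        _ = 1 / 2 := by norm_num)
    (fun n _ h _ => h) (fun n _ _ h => h.le)
    (fun n hn => by have := h1 n hn; have : 0 < 1 / P ^ 6 := by positivity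
                    linarith)
  refine le_add_of_sq_le_add_sq (by positivity)
    (mul_nonneg (by positivity) (pow_nonneg dyadicRatio_nonneg _)) (key.trans (add_le_add ?_ ?_))
  · rw [div_le_iff₀ hJ0]
    have h3 : (8 * √2 ^ i * √(P ^ 3)) ^ 2 = 64 * t * P := by
      rw [mul_pow, mul_pow, ← pow_mul, mul_comm i 2, pow_mul, Real.sq_sqrt (by norm_num),
        Real.sq_sqrt (by positivity), ht]
      ring
    rw [h3]
    calc 2 * (2 * t) ^ 2 = 64 * t * q * (t / (8 * q)) := by field_simp; norm_num
      _ ≤ 64 * t * P * J := by gcongr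
  · have h3 : (8 : ℝ) ^ i / 4 ≤ J * (t * (q / P ^ 6)) * (2 * t) := by
      calc (8 : ℝ) ^ i / 4 = t / (8 * q) * (t * (q / P ^ 6)) * (2 * t) := by
            rw [ht, show (8 : ℝ) ^ i = (2 ^ i) ^ 3 by rw [← pow_mul, mul_comm, pow_mul]; norm_num]
            field_simp
            norm_num
        _ ≤ _ := by gcongr
    have h4 : (J * (t * (q / P ^ 6)) * (2 * t)) ^ (-(3 / 4) : ℝ) ≤
        4 * ((8 : ℝ) ^ (-(3 / 4) : ℝ)) ^ i := by
      calc _ ≤ ((8 : ℝ) ^ i / 4) ^ (-(3 / 4) : ℝ) :=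
            Real.rpow_le_rpow_of_nonpos (by positivity) h3 (by norm_num)
        _ = ((4 : ℝ)⁻¹) ^ (-(3 / 4) : ℝ) * ((8 : ℝ) ^ (-(3 / 4) : ℝ)) ^ i := by
            rw [div_eq_inv_mul, Real.mul_rpow (by positivity) (by positivity),
              ← Real.rpow_natCast, ← Real.rpow_natCast, ← Real.rpow_mul (by norm_num),
              ← Real.rpow_mul (by norm_num), mul_comm (i : ℝ)]
        _ ≤ _ := by
            gcongr
            rw [Real.inv_rpow (by norm_num), Real.rpow_neg (by norm_num), inv_inv]
            calc (4 : ℝ) ^ (3 / 4 : ℝ) ≤ 4 ^ (1 : ℝ) :=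
                  Real.rpow_le_rpow_of_exponent_le (by norm_num) (by norm_num)
              _ = 4 := by norm_num
    calc 16 * (2 * t) ^ 2 * (J * (t * (q / P ^ 6)) * (2 * t)) ^ (-(3 / 4) : ℝ)
        ≤ 16 * (2 * t) ^ 2 * (4 * ((8 : ℝ) ^ (-(3 / 4) : ℝ)) ^ i) := by gcongr
      _ = (16 * P ^ 2 * dyadicRatio ^ i) ^ 2 := by
        rw [mul_pow _ (dyadicRatio ^ i), ← pow_mul, mul_comm i 2, pow_mul, dyadicRatio,
          Real.sq_sqrt (by positivity), mul_pow 4, ht,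
          show (4 : ℝ) ^ i = (2 ^ i) ^ 2 by rw [← pow_mul, mul_comm, pow_mul]; norm_num]
        ring

theorem norm_far_piece_le {σ : ℝ} (hσ : σ = 1 ∨ σ = -1) (hP : 1000 ≤ P) (hM : (M : ℝ) ≤ P ^ 3)
    (h1 : ∀ n < M, 1 / P ^ 6 ≤ secondDiff f (n + 1) - secondDiff f n)
    (hq : 1 ≤ q) {Z : ℝ} (hZ : q / P ^ 3 ≤ Z)
    (hvar : ∀ n < M, ∀ n' < M, σ * (q * secondDiff f n - a) ≤
      σ * (q * secondDiff f n' - a) + 125 * (q / P ^ 3))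
    (hup : ∀ n < M, σ * (q * secondDiff f n - a) ≤ 126 / P ^ 2) :
    ‖∑ n ∈ range M with Z ≤ σ * (q * secondDiff f n - a) ∧
      σ * (q * secondDiff f n - a) < 1, e2pi (f n)‖ ≤ 1100 * P ^ 2 := by
  have hP0 : 0 < P := by linarith
  have hq0 : (0 : ℝ) < q := by exact_mod_cast hq
  rcases (filter (fun n => Z ≤ σ * (q * secondDiff f n - a) ∧
      σ * (q * secondDiff f n - a) < 1) (range M)).eq_empty_or_nonempty with he | ⟨n₁, hn₁⟩
  · rw [he]; simp; positivity
  rw [mem_filter, mem_range] at hn₁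
  set y : ℝ := σ * (q * secondDiff f n₁ - a) with hy
  have hZ0 : 0 < q / P ^ 3 := by positivity
  have hyZ : q / P ^ 3 ≤ y := hZ.trans hn₁.2.1
  have hy0 : 0 < y := by linarith
  have hyup : y ≤ 126 / P ^ 2 := hup n₁ hn₁.1
  have hyP : y * P ^ 2 ≤ 126 := by rwa [le_div_iff₀ (by positivity)] at hyup
  set J : ℕ := ⌊1 / (252 * y)⌋₊ with hJ
  have hJ2 : 2 ≤ 1 / (252 * y) := by
    rw [le_div_iff₀ (by positivity)]; nlinarith
  have hJle : (J : ℝ) ≤ 1 / (252 * y) := Nat.floor_le (by positivity)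
  have hJge : 1 / (504 * y) ≤ J := by
    have h3 : 1 / (252 * y) < J + 1 := Nat.lt_floor_add_one _
    have h4 : 1 / (504 * y) = 1 / (252 * y) / 2 := by field_simp; norm_num
    rw [h4]; linarith
  have hJ1 : 1 ≤ J := Nat.le_floor (by push_cast; linarith)
  have hJ0 : (0 : ℝ) < J := by exact_mod_cast hJ1
  have hqJ : (q * J : ℝ) ≤ P ^ 3 := by
    have h3 : q ≤ y * P ^ 3 := by rwa [div_le_iff₀ (by positivity)] at hyZ
    calc (q * J : ℝ) ≤ y * P ^ 3 * (1 / (252 * y)) := by gcongr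
      _ = P ^ 3 / 252 := by field_simp
      _ ≤ P ^ 3 := by linarith [pow_pos hP0 3]
  have key := norm_sum_filter_sq_le f M q J a (δ := y / 126) (v := 1)
    (δ' := 126 * y) (L := P ^ 3) hσ hq hJ1 Z
    (by
      refine le_trans ?_ hM
      exact_mod_cast (card_filter_le _ _).trans (card_range M).le) hqJ (by positivity) (by
      calc J * (126 * y) ≤ 1 / (252 * y) * (126 * y) := by gcongr
        _ = 1 / 2 := by field_simp; norm_num)
    (fun n hn h _ => by have := hvar n₁ hn₁.1 n hn; linarith)
    (fun n hn _ _ => by have := hvar n hn n₁ hn₁.1; linarith)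
    (fun n hn => by have := h1 n hn; have : 0 < 1 / P ^ 6 := by positivity
                    linarith)
  refine abs_le_of_sq_le_sq' (key.trans ?_) (by positivity) |>.2
  have hA : 2 * (P ^ 3) ^ 2 / J ≤ 127008 * P ^ 4 := by
    rw [div_le_iff₀ hJ0]
    calc 2 * (P ^ 3) ^ 2 = 1008 * P ^ 4 * (y * P ^ 2) * (1 / (504 * y)) := by field_simp; norm_num
      _ ≤ 1008 * P ^ 4 * 126 * J := by gcongr
      _ = _ := by ring
  have hB : (J * (y / 126) * P ^ 3) ^ (-(3 / 4) : ℝ) ≤ 63504 * (1 / P ^ 2) := by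
    have h3 : P ^ 3 / 63504 ≤ J * (y / 126) * P ^ 3 := by
      calc P ^ 3 / 63504 = 1 / (504 * y) * (y / 126) * P ^ 3 := by field_simp; norm_num
        _ ≤ _ := by gcongr
    calc _ ≤ (P ^ 3 / 63504) ^ (-(3 / 4) : ℝ) :=
          Real.rpow_le_rpow_of_nonpos (by positivity) h3 (by norm_num)
      _ = ((63504 : ℝ)⁻¹) ^ (-(3 / 4) : ℝ) * P ^ (-(9 / 4) : ℝ) := by
          rw [div_eq_inv_mul, Real.mul_rpow (by positivity) (by positivity),
            ← Real.rpow_natCast P 3, ← Real.rpow_mul hP0.le]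
          norm_num
      _ ≤ 63504 * (1 / P ^ 2) := by
          gcongr
          · rw [Real.inv_rpow (by norm_num), Real.rpow_neg (by norm_num), inv_inv]
            calc (63504 : ℝ) ^ (3 / 4 : ℝ) ≤ 63504 ^ (1 : ℝ) :=
                  Real.rpow_le_rpow_of_exponent_le (by norm_num) (by norm_num)
              _ = 63504 := by norm_num
          · calc P ^ (-(9 / 4) : ℝ) ≤ P ^ (-2 : ℝ) :=
                  Real.rpow_le_rpow_of_exponent_le (by linarith) (by norm_num)
              _ = 1 / P ^ 2 := by
                  rw [Real.rpow_neg hP0.le, one_div]; norm_num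
  calc 2 * (P ^ 3) ^ 2 / J + 16 * (P ^ 3) ^ 2 * (J * (y / 126) * P ^ 3) ^ (-(3 / 4) : ℝ)
      ≤ 127008 * P ^ 4 + 16 * (P ^ 3) ^ 2 * (63504 * (1 / P ^ 2)) := by gcongr
    _ = 1143072 * P ^ 4 := by field_simp; norm_num
    _ ≤ (1100 * P ^ 2) ^ 2 := by nlinarith [pow_pos hP0 4]

theorem sum_filter_split {g : ℕ → ℝ} (F : ℕ → ℂ) {u v w : ℝ} (huv : u ≤ v) (hvw : v ≤ w) :
    ∑ n ∈ range M with u ≤ g n ∧ g n < w, F n =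
      ∑ n ∈ range M with u ≤ g n ∧ g n < v, F n + ∑ n ∈ range M with v ≤ g n ∧ g n < w, F n := by
  rw [sum_filter, sum_filter, sum_filter, ← sum_add_distrib]
  refine sum_congr rfl fun n _ => ?_
  split_ifs <;> first | (simp; done) | (exfalso; grind)

/-- The contribution of one side of a rational number with small denominator. -/
theorem norm_one_side_le {σ : ℝ} (hσ : σ = 1 ∨ σ = -1) (hP : 1000 ≤ P) (hM : (M : ℝ) ≤ P ^ 3)
    (h1 : ∀ n < M, 1 / P ^ 6 ≤ secondDiff f (n + 1) - secondDiff f n)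
    (hq : 1 ≤ q) (hqP : (q : ℝ) ≤ P)
    (hvar : ∀ n < M, ∀ n' < M, σ * (q * secondDiff f n - a) ≤
      σ * (q * secondDiff f n' - a) + 125 * (q / P ^ 3))
    (hup : ∀ n < M, σ * (q * secondDiff f n - a) ≤ 126 / P ^ 2) :
    ‖∑ n ∈ range M with q / P ^ 4 ≤ σ * (q * secondDiff f n - a) ∧
      σ * (q * secondDiff f n - a) < 1, e2pi (f n)‖ ≤
      (1148 + 16 / (1 - dyadicRatio)) * P ^ 2 := by
  have hP0 : 0 < P := by linarith
  have hq0 : (0 : ℝ) < q := by exact_mod_cast hq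
  have hr := dyadicRatio_lt_one
  have hr0 := dyadicRatio_nonneg
  have hs2 : (√2) ^ 2 = 2 := Real.sq_sqrt (by norm_num)
  have hs1 : 7 / 5 ≤ √2 := Real.le_sqrt_of_sq_le (by norm_num)
  have hex : ∃ k : ℕ, P ≤ 2 ^ k := pow_unbounded_of_one_lt P (by norm_num : (1 : ℝ) < 2) |>.imp
    fun _ h => h.le
  obtain ⟨k, hk, hkmin⟩ : ∃ k : ℕ, P ≤ 2 ^ k ∧ ∀ i < k, (2 : ℝ) ^ i < P := by
    classical
    exact ⟨Nat.find hex, Nat.find_spec hex, fun i hi => not_le.1 (Nat.find_min hex hi)⟩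
  have hdy : ∀ j ≤ k, ‖∑ n ∈ range M with q / P ^ 4 ≤ σ * (q * secondDiff f n - a) ∧
      σ * (q * secondDiff f n - a) < 2 ^ j * (q / P ^ 4), e2pi (f n)‖ ≤
      8 * √(P ^ 3) * ∑ i ∈ range j, √2 ^ i + 16 * P ^ 2 * ∑ i ∈ range j, dyadicRatio ^ i := by
    intro j
    induction j with
    | zero =>
      intro _
      rw [filter_false_of_mem]
      · simp
      · intro n _
        grind
    | succ j ih =>
      intro hj
      have h3 := norm_dyadic_piece_le (f := f) (M := M) (a := a) hσ hP h1 hq hqP j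
        (hkmin j (by omega)).le
      have hj1 : (1 : ℝ) ≤ 2 ^ j := one_le_pow₀ (by norm_num)
      have hY : 0 < q / P ^ 4 := by positivity
      rw [sum_filter_split (v := 2 ^ j * (q / P ^ 4)) _ (by nlinarith)
        (by rw [pow_succ (2 : ℝ) j]; nlinarith), sum_range_succ, sum_range_succ]
      refine (norm_add_le _ _).trans ((add_le_add (ih (by omega)) h3).trans (le_of_eq ?_))
      ring
  have hdk := hdy k le_rfl
  have hg1 : ∑ i ∈ range k, dyadicRatio ^ i ≤ 1 / (1 - dyadicRatio) := by
    rw [geom_sum_eq hr.ne, ← neg_div_neg_eq, neg_sub, neg_sub]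
    gcongr
    linarith [pow_nonneg hr0 k]
  have hkpos : k ≠ 0 := by
    rintro rfl
    norm_num at hk
    linarith
  have h2k : (2 : ℝ) ^ k ≤ 2 * P := by
    obtain ⟨j, rfl⟩ := Nat.exists_eq_succ_of_ne_zero hkpos
    rw [pow_succ]
    linarith [hkmin j (by omega)]
  have hg2 : 8 * √(P ^ 3) * ∑ i ∈ range k, √2 ^ i ≤ 48 * P ^ 2 := by
    have h3 : ∑ i ∈ range k, √2 ^ i ≤ 5 / 2 * √2 ^ k := by
      rw [geom_sum_eq (by linarith), div_le_iff₀ (by linarith)]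
      nlinarith [pow_pos (show (0 : ℝ) < √2 by linarith) k]
    have h4 : √(P ^ 3) * √2 ^ k ≤ 12 / 5 * P ^ 2 := by
      refine abs_le_of_sq_le_sq' ?_ (by positivity) |>.2
      rw [mul_pow, Real.sq_sqrt (by positivity), ← pow_mul, mul_comm k 2, pow_mul, hs2]
      calc P ^ 3 * 2 ^ k ≤ P ^ 3 * (2 * P) := by gcongr
        _ ≤ _ := by nlinarith [pow_pos hP0 4]
    calc 8 * √(P ^ 3) * ∑ i ∈ range k, √2 ^ i ≤ 8 * √(P ^ 3) * (5 / 2 * √2 ^ k) := by gcongr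
      _ = 20 * (√(P ^ 3) * √2 ^ k) := by ring
      _ ≤ 20 * (12 / 5 * P ^ 2) := by gcongr
      _ = _ := by ring
  have hZ : q / P ^ 3 ≤ 2 ^ k * (q / P ^ 4) := by
    calc q / P ^ 3 = P * (q / P ^ 4) := by field_simp
      _ ≤ _ := by gcongr
  have hfar := norm_far_piece_le (f := f) (M := M) (a := a) hσ hP hM h1 hq hZ hvar hup
  have hZ1 : 2 ^ k * (q / P ^ 4) ≤ 1 := by
    calc 2 ^ k * (q / P ^ 4) ≤ 2 * P * (P / P ^ 4) := by gcongr
      _ = 2 / P ^ 2 := by field_simp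
      _ ≤ 1 := by rw [div_le_one (by positivity)]; nlinarith
  have h2k1 : (1 : ℝ) ≤ 2 ^ k := one_le_pow₀ (by norm_num)
  have hY : 0 < q / P ^ 4 := by positivity
  rw [sum_filter_split (v := 2 ^ k * (q / P ^ 4)) _ (by nlinarith) hZ1]
  refine (norm_add_le _ _).trans ((add_le_add hdk hfar).trans ?_)
  have h5 : 16 * P ^ 2 * ∑ i ∈ range k, dyadicRatio ^ i ≤ 16 * P ^ 2 * (1 / (1 - dyadicRatio)) := by
    gcongr
  have h6 : (1148 + 16 / (1 - dyadicRatio)) * P ^ 2 =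
    1148 * P ^ 2 + 16 * P ^ 2 * (1 / (1 - dyadicRatio)) := by ring
  rw [h6]
  linarith

/-- The exponential sum when the second difference is close to a rational with denominator at
most `P`. -/
theorem norm_sum_le_of_small_denominator (hP : 1000 ≤ P) (hM : (M : ℝ) ≤ P ^ 3)
    (h1 : ∀ n < M, 1 / P ^ 6 ≤ secondDiff f (n + 1) - secondDiff f n)
    (h2 : ∀ n < M, secondDiff f (n + 1) - secondDiff f n ≤ 125 * (1 / P ^ 6))
    (hq : 1 ≤ q) (hqP : (q : ℝ) ≤ P) (ha : |q * secondDiff f 0 - a| ≤ 1 / P ^ 2) :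
    ‖∑ n ∈ range M, e2pi (f n)‖ ≤ (2300 + 32 / (1 - dyadicRatio)) * P ^ 2 := by
  have hP0 : 0 < P := by linarith
  have hq0 : (0 : ℝ) < q := by exact_mod_cast hq
  have hlin := secondDiff_bounds (by positivity) h1 h2
  have hlin' : ∀ n < M, (q * secondDiff f 0 - a : ℝ) ≤ q * secondDiff f n - a ∧
      (q * secondDiff f n - a : ℝ) ≤ q * secondDiff f 0 - a + 125 * (q / P ^ 3) := by
    intro n hn
    obtain ⟨h3, h4⟩ := hlin n hn
    have h5 : (n : ℝ) * (125 * (1 / P ^ 6)) ≤ 125 * (1 / P ^ 3) := by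
      calc (n : ℝ) * (125 * (1 / P ^ 6)) ≤ P ^ 3 * (125 * (1 / P ^ 6)) := by
            gcongr
            exact le_trans (by exact_mod_cast hn.le) hM
        _ = _ := by field_simp
    have h6 := mul_le_mul_of_nonneg_left h3 hq0.le
    have h7 := mul_le_mul_of_nonneg_left (h4.trans (add_le_add_right h5 _)) hq0.le
    have h8 : q * (125 * (1 / P ^ 3)) = 125 * (q / P ^ 3) := by ring
    constructor <;> linarith
  have hqP2 : 125 * (q / P ^ 3) ≤ 125 / P ^ 2 := by
    calc 125 * (q / P ^ 3) ≤ 125 * (P / P ^ 3) := by gcongr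
      _ = _ := by field_simp
  have h126 : 126 / P ^ 2 = 125 / P ^ 2 + 1 / P ^ 2 := by ring
  obtain ⟨ha1, ha2⟩ := abs_le.1 ha
  have hvar0 : 0 ≤ 125 * (q / P ^ 3) := by positivity
  have hplus := norm_one_side_le (f := f) (M := M) (a := a) (σ := 1) (Or.inl rfl) hP hM h1 hq hqP
    (fun n hn n' hn' => by have := hlin' n hn; have := hlin' n' hn'; linarith)
    (fun n hn => by have := hlin' n hn; linarith)
  have hminus := norm_one_side_le (f := f) (M := M) (a := a) (σ := -1) (Or.inr rfl) hP hM h1 hq hqP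
    (fun n hn n' hn' => by have := hlin' n hn; have := hlin' n' hn'; linarith)
    (fun n hn => by have := hlin' n hn; linarith)
  have hcard := card_filter_le_of_step (fun n => q * secondDiff f n - a) M (Or.inl rfl)
    (μ := q / P ^ 6) (by positivity) (step_mul_secondDiff (q := q) (a := a) h1)
    (u := -(q / P ^ 4)) (v := q / P ^ 4) (T := 2 * P ^ 2) (by positivity)
    (le_of_eq (by field_simp; norm_num))
  have hmid : ‖∑ n ∈ range M with ¬ q / P ^ 4 ≤ 1 * (q * secondDiff f n - a) ∧
      ¬ q / P ^ 4 ≤ -1 * (q * secondDiff f n - a), e2pi (f n)‖ ≤ 2 * P ^ 2 + 1 := by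
    refine (norm_sum_e2pi_le _ _).trans (le_trans ?_ hcard)
    refine Nat.cast_le.2 (card_le_card fun n hn => ?_)
    rw [mem_filter] at hn ⊢
    refine ⟨hn.1, ?_, ?_⟩ <;> [linarith [hn.2.2]; linarith [hn.2.1]]
  have hsplit : ∑ n ∈ range M, e2pi (f n) =
      ∑ n ∈ range M with q / P ^ 4 ≤ 1 * (q * secondDiff f n - a) ∧
        1 * (q * secondDiff f n - a) < 1, e2pi (f n) +
      ∑ n ∈ range M with q / P ^ 4 ≤ -1 * (q * secondDiff f n - a) ∧
        -1 * (q * secondDiff f n - a) < 1, e2pi (f n) +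
      ∑ n ∈ range M with ¬ q / P ^ 4 ≤ 1 * (q * secondDiff f n - a) ∧
        ¬ q / P ^ 4 ≤ -1 * (q * secondDiff f n - a), e2pi (f n) := by
    rw [sum_filter, sum_filter, sum_filter, ← sum_add_distrib, ← sum_add_distrib]
    refine sum_congr rfl fun n hn => ?_
    rw [mem_range] at hn
    have h3 := hlin' n hn
    have h4 : 126 / P ^ 2 < 1 := by rw [div_lt_one (by positivity)]; nlinarith
    have h5 : 1 * (q * secondDiff f n - a) < 1 := by linarith
    have h6 : -1 * (q * secondDiff f n - a) < 1 := by linarith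
    have h7 : 0 < q / P ^ 4 := by positivity
    simp only [h5, h6, and_true]
    split_ifs <;> first | (simp; done) | (exfalso; linarith) | tauto
  rw [hsplit]
  refine norm_add₃_le.trans ((add_le_add (add_le_add hplus hminus) hmid).trans ?_)
  have h8 : (2300 + 32 / (1 - dyadicRatio)) * P ^ 2 =
    2 * ((1148 + 16 / (1 - dyadicRatio)) * P ^ 2) + 4 * P ^ 2 := by ring
  rw [h8]
  nlinarith

end NearRational

/-- The residue of `-(h * a)` modulo `q`. -/
def negResidue (a : ℤ) (q h : ℕ) : ℕ := (-(h * a : ℤ) % q).toNat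

theorem negResidue_cast {q : ℕ} (hq : 1 ≤ q) (a : ℤ) (h : ℕ) :
    (negResidue a q h : ℤ) = -(h * a : ℤ) % q :=
  Int.toNat_of_nonneg (Int.emod_nonneg _ (by omega))

theorem negResidue_lt {q : ℕ} (hq : 1 ≤ q) (a : ℤ) (h : ℕ) : negResidue a q h < q := by
  have h1 := negResidue_cast hq a h
  have h2 := Int.emod_lt_of_pos (-(h * a : ℤ)) (show (0 : ℤ) < q by omega)
  omega

theorem exists_mul_eq_sub_negResidue {q : ℕ} (hq : 1 ≤ q) (a : ℤ) (h : ℕ) :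
    ∃ m : ℤ, (h * a : ℤ) = m * q - negResidue a q h := by
  refine ⟨-(-(h * a : ℤ) / q), ?_⟩
  have h1 := negResidue_cast hq a h
  have h2 := Int.emod_add_mul_ediv (-(h * a : ℤ)) q
  rw [h1]
  linarith

theorem negResidue_add_mul (a : ℤ) (q j i : ℕ) :
    negResidue a q (q * j + i) = negResidue a q i := by
  rw [negResidue, negResidue]
  congr 1
  refine Int.emod_emod_of_dvd _ dvd_rfl |>.symm.trans ?_
  push_cast
  rw [show -((q * j + i) * a : ℤ) = -(i * a) + q * (-(j * a)) by ring, Int.add_mul_emod_self_left,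
    Int.emod_emod_of_dvd _ dvd_rfl]

theorem dvd_sub_of_negResidue_eq {q : ℕ} (hq : 1 ≤ q) {a : ℤ} (hc : IsCoprime (q : ℤ) a) {i j : ℕ}
    (h : negResidue a q i = negResidue a q j) : (q : ℤ) ∣ i - j := by
  have h1 : (-(i * a : ℤ)) % q = (-(j * a : ℤ)) % q := by
    rw [← negResidue_cast hq, ← negResidue_cast hq, h]
  have h2 := Int.emod_emod_of_dvd (-(i * a : ℤ)) (dvd_refl (q : ℤ))
  have h3 : (q : ℤ) ∣ (i - j) * a := by
    have := Int.ModEq.dvd (n := q) h1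
    rwa [show -(j * a : ℤ) - -(i * a) = (i - j) * a by ring] at this
  exact hc.dvd_of_dvd_mul_right h3

theorem sum_negResidue_le {q : ℕ} (hq : 1 ≤ q) {a : ℤ} (hc : IsCoprime (q : ℤ) a) (G : ℕ → ℝ)
    (hG : ∀ s < q, 0 ≤ G s) (B : ℕ) :
    ∑ h ∈ range (q * B), G (negResidue a q h) ≤ B * ∑ s ∈ range q, G s := by
  have hone : ∑ i ∈ range q, G (negResidue a q i) ≤ ∑ s ∈ range q, G s := by
    have hinj : Set.InjOn (negResidue a q) (range q) := by
      intro i hi j hj hij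
      have h1 := dvd_sub_of_negResidue_eq hq hc hij
      simp only [coe_range, Set.mem_Iio] at hi hj
      have h2 := Int.eq_zero_of_abs_lt_dvd h1 (by rw [abs_lt]; constructor <;> omega)
      omega
    rw [← sum_image hinj]
    refine sum_le_sum_of_subset_of_nonneg ?_ fun s hs _ => hG s (mem_range.1 hs)
    intro s hs
    obtain ⟨i, -, rfl⟩ := mem_image.1 hs
    exact mem_range.2 (negResidue_lt hq a i)
  induction B with
  | zero => simp
  | succ B ih =>
    rw [mul_add, mul_one, sum_range_add]
    simp only [negResidue_add_mul]
    push_cast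
    linarith

theorem sum_one_div_sqrt_le (n : ℕ) : ∑ i ∈ range n, 1 / √((i : ℝ) + 1) ≤ 2 * √n := by
  induction n with
  | zero => simp
  | succ n ih =>
    rw [sum_range_succ]
    push_cast
    have h1 : 0 < √((n : ℝ) + 1) := by positivity
    have h2 : √((n : ℝ) + 1) * √((n : ℝ) + 1) = n + 1 := Real.mul_self_sqrt (by positivity)
    have h3 : √(n : ℝ) * √(n : ℝ) = n := Real.mul_self_sqrt (by positivity)
    have h4 : 1 / √((n : ℝ) + 1) ≤ 2 * √((n : ℝ) + 1) - 2 * √n := by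
      rw [div_le_iff₀ h1]
      nlinarith [sq_nonneg (√((n : ℝ) + 1) - √n)]
    linarith

theorem sum_one_div_sqrt_le' (n : ℕ) : ∑ s ∈ range (n + 1), 1 / √(s : ℝ) ≤ 2 * √n := by
  rw [sum_range_succ']
  simpa using sum_one_div_sqrt_le n

theorem one_div_le_one_div_sqrt (s : ℕ) : 1 / (s : ℝ) ≤ 1 / √s := by
  rcases Nat.eq_zero_or_pos s with rfl | hs
  · simp
  · have h1 : (1 : ℝ) ≤ s := by exact_mod_cast hs
    gcongr
    rw [Real.sqrt_le_left (by linarith)]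
    nlinarith

section LargeDenominator

variable {f : ℕ → ℝ} {M q : ℕ} {a : ℤ} {P : ℝ}

/-- Majorant for a correlation sum whose shift `h` satisfies `h * a ≡ -s` modulo `q`. -/
noncomputable def residueMajorant (P : ℝ) (q s : ℕ) : ℝ :=
  4 * q * (1 / s) + 4 * q * (1 / ((q : ℝ) - s)) +
    if (s : ℝ) ≤ 250 * q / P then 10 * √(250 * q * P ^ 3) * (1 / √s) else 0

theorem residueMajorant_nonneg {s : ℕ} (hs : s < q) : 0 ≤ residueMajorant P q s := by
  have h1 : (0 : ℝ) < q - s := by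
    have : (s : ℝ) < q := by exact_mod_cast hs
    linarith
  rw [residueMajorant]
  split_ifs <;> positivity

theorem sum_residueMajorant_le (hP : 0 < P) (hq : 1 ≤ q) :
    ∑ s ∈ range q, residueMajorant P q s ≤ q * (16 * √q + 5000 * P) := by
  have hq0 : (0 : ℝ) < q := by exact_mod_cast hq
  simp only [residueMajorant, sum_add_distrib, ← mul_sum]
  have h1 : ∑ s ∈ range q, 1 / (s : ℝ) ≤ 2 * √q := by
    refine (sum_le_sum fun s _ => one_div_le_one_div_sqrt s).trans
      (le_trans ?_ (sum_one_div_sqrt_le' q))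
    exact sum_le_sum_of_subset_of_nonneg (range_mono (by omega)) fun _ _ _ => by positivity
  have h2 : ∑ s ∈ range q, 1 / ((q : ℝ) - s) ≤ 2 * √q := by
    rw [← sum_range_reflect]
    refine le_trans (sum_le_sum fun s hs => ?_) (sum_one_div_sqrt_le q)
    rw [mem_range] at hs
    have h3 : ((q - 1 - s : ℕ) : ℝ) = q - 1 - s := by
      rw [Nat.cast_sub (by omega), Nat.cast_sub hq]; simp
    have h4 := one_div_le_one_div_sqrt (s + 1)
    push_cast at h4
    rwa [h3, show (q : ℝ) - (q - 1 - s) = s + 1 by ring]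
  have h3 : ∑ s ∈ range q, (if (s : ℝ) ≤ 250 * q / P then 10 * √(250 * q * P ^ 3) * (1 / √(s : ℝ))
      else 0) ≤ 5000 * q * P := by
    rw [← sum_filter, ← mul_sum]
    set R := ⌊250 * q / P⌋₊ with hR
    have h5 : ∑ s ∈ range q with ((s : ℕ) : ℝ) ≤ 250 * q / P, 1 / √(s : ℝ) ≤
        2 * √(250 * q / P) := by
      refine le_trans ?_ ((sum_one_div_sqrt_le' R).trans ?_)
      · refine sum_le_sum_of_subset_of_nonneg (fun s hs => ?_) fun _ _ _ => by positivity
        rw [mem_filter] at hs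
        have := Nat.le_floor hs.2
        rw [mem_range]
        omega
      · gcongr
        exact Nat.floor_le (by positivity)
    calc _ ≤ 10 * √(250 * q * P ^ 3) * (2 * √(250 * q / P)) := by gcongr
      _ = 20 * (√(250 * q * P ^ 3) * √(250 * q / P)) := by ring
      _ = 20 * √((250 * q * P) ^ 2) := by
        rw [← Real.sqrt_mul (by positivity)]
        congr 2
        field_simp
      _ = _ := by
        rw [Real.sqrt_sq (by positivity)]
        ring
  calc _ ≤ 4 * q * (2 * √q) + 4 * q * (2 * √q) + 5000 * q * P := by gcongr
    _ = _ := by ring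

theorem norm_corr_le (hP : 1000 ≤ P) (hM : (M : ℝ) ≤ P ^ 3)
    (h1 : ∀ n < M, 1 / P ^ 6 ≤ secondDiff f (n + 1) - secondDiff f n)
    (h2 : ∀ n < M, secondDiff f (n + 1) - secondDiff f n ≤ 125 * (1 / P ^ 6))
    {h : ℕ} (hh : 1 ≤ h) (hhP : (h : ℝ) ≤ P ^ 2) :
    ‖∑ n ∈ range (M - h), e2pi (f (n + h) - f n)‖ ≤ 10 * P ^ 3 * (1 / √h) := by
  have hP0 : 0 < P := by linarith
  refine (norm_corr_le_of_thirdDiff f M (lam := 1 / P ^ 6) (by positivity) h1 h2 h hh ?_ ?_).trans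
    (le_of_eq ?_)
  · calc (h : ℝ) * (1 / P ^ 6) ≤ P ^ 2 * (1 / P ^ 6) := by gcongr
      _ = 1 / P ^ 4 := by field_simp
      _ ≤ 1 := by
        rw [div_le_one (by positivity)]
        exact one_le_pow₀ (by linarith)
  · calc 125 * (h : ℝ) * (1 / P ^ 6) * M ≤ 125 * P ^ 2 * (1 / P ^ 6) * P ^ 3 := by gcongr
      _ = 125 / P := by field_simp
      _ ≤ 1 / 2 := by
        rw [div_le_div_iff₀ hP0 (by norm_num)]
        linarith
  · rw [mul_one_div, Real.sqrt_div (by positivity), show P ^ 6 = (P ^ 3) ^ 2 by ring,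
      Real.sqrt_sq (by positivity)]
    have : 0 < √(h : ℝ) := Real.sqrt_pos.2 (by exact_mod_cast hh)
    field_simp

theorem norm_corr_le_residueMajorant (hP : 1000 ≤ P) (hM : (M : ℝ) ≤ P ^ 3)
    (h1 : ∀ n < M, 1 / P ^ 6 ≤ secondDiff f (n + 1) - secondDiff f n)
    (h2 : ∀ n < M, secondDiff f (n + 1) - secondDiff f n ≤ 125 * (1 / P ^ 6))
    {h s : ℕ} {m : ℤ} (hh : 1 ≤ h) (hhP : (h : ℝ) ≤ P ^ 2) (hs : 1 ≤ s) (hsq : s < q)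
    (hm : (h * a : ℤ) = m * q - s) (ha : 4 * h * |q * secondDiff f 0 - a| ≤ 1) :
    ‖∑ n ∈ range (M - h), e2pi (f (n + h) - f n)‖ ≤ residueMajorant P q s := by
  have hP0 : 0 < P := by linarith
  have hs0 : (0 : ℝ) < s := by exact_mod_cast hs
  have hs1 : (1 : ℝ) ≤ s := by exact_mod_cast hs
  have hqs : (s : ℝ) + 1 ≤ q := by exact_mod_cast hsq
  have hq0 : (0 : ℝ) < q := by linarith
  have hh0 : (0 : ℝ) < h := by exact_mod_cast hh
  have hqs0 : (0 : ℝ) < q - s := by linarith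
  set V : ℝ := 125 * h / P ^ 3 with hV
  have hmR : (h * a : ℝ) = m * q - s := by exact_mod_cast hm
  rcases le_or_gt V (s / (2 * q)) with hVs | hVs
  · have hkl : ‖∑ n ∈ range (M - h), e2pi (f (n + h) - f n)‖ ≤
        1 / (min (s : ℝ) ((q : ℝ) - s) / (4 * q)) := by
      have hD : ∀ n < M - h, h * secondDiff f 0 ≤ (f (n + 1 + h) - f (n + 1)) - (f (n + h) - f n) ∧
          (f (n + 1 + h) - f (n + 1)) - (f (n + h) - f n) ≤ h * secondDiff f 0 + V := by
        intro n hn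
        rw [shift_diff_eq_sum_secondDiff]
        have hb : ∀ i ∈ range h, secondDiff f 0 ≤ secondDiff f (n + i) ∧
            secondDiff f (n + i) ≤ secondDiff f 0 + P ^ 3 * (125 * (1 / P ^ 6)) := by
          intro i hi
          rw [mem_range] at hi
          have h3 := secondDiff_bounds (by positivity) h1 h2 (n + i) (by omega)
          refine ⟨h3.1, h3.2.trans ?_⟩
          gcongr
          refine le_trans ?_ hM
          exact_mod_cast (by omega : n + i ≤ M)
        constructor
        · simpa using sum_le_sum fun i hi => (hb i hi).1
        · refine (sum_le_sum fun i hi => (hb i hi).2).trans (le_of_eq ?_)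
          rw [sum_const, card_range, nsmul_eq_mul, hV]
          field_simp
      have hth : |h * secondDiff f 0 - (m - s / q)| ≤ 1 / (4 * q) := by
        have h3 : h * secondDiff f 0 - (m - s / q) = h * (q * secondDiff f 0 - a) / q := by
          rw [eq_div_iff hq0.ne']
          have : (s / q * q : ℝ) = s := by field_simp
          linear_combination hmR + this
        rw [h3, abs_div, abs_mul, abs_of_pos hh0, abs_of_pos hq0, div_le_div_iff₀ hq0 (by positivity)]
        nlinarith
      obtain ⟨hth1, hth2⟩ := abs_le.1 hth
      have e1 : (s / (4 * q) : ℝ) = s / q / 4 := by field_simp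
      have e2 : (s / (2 * q) : ℝ) = s / q / 2 := by field_simp
      have e3 : (1 / (4 * q) : ℝ) = 1 / q / 4 := by field_simp
      have e4 : ((q - s) / (4 * q) : ℝ) = 1 / 4 - s / q / 4 := by field_simp
      have e5 : (1 / q : ℝ) ≤ s / q := by gcongr
      have e6 : (s / q + 1 / q : ℝ) ≤ 1 := by
        rw [← add_div, div_le_one hq0]; exact hqs
      have hmin1 : min (s : ℝ) (q - s) / (4 * q) ≤ s / (4 * q) := by gcongr; exact min_le_left _ _
      have hmin2 : min (s : ℝ) (q - s) / (4 * q) ≤ (q - s) / (4 * q) := by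
        gcongr; exact min_le_right _ _
      have hmin0 : 0 < min (s : ℝ) (q - s) := lt_min hs0 hqs0
      refine kusmin_landau (fun n => f (n + h) - f n) (M - h) (m - 1) (by positivity) ?_ ?_ ?_
      · intro n hn
        have := (hD n hn).1
        push_cast
        linarith
      · intro n hn
        have := (hD n hn).2
        push_cast
        linarith
      · intro n hn
        have h3 := shift_diff_step f h n
        have h4 : 0 ≤ ∑ i ∈ range h, (secondDiff f (n + i + 1) - secondDiff f (n + i)) := by
          refine sum_nonneg fun i hi => ?_
          rw [mem_range] at hi
          have h5 := h1 (n + i) (by omega)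
          have h6 : 0 < 1 / P ^ 6 := by positivity
          linarith
        linarith
    refine hkl.trans ?_
    have h5 : 1 / (min (s : ℝ) (q - s) / (4 * q)) ≤ 4 * q * (1 / s) + 4 * q * (1 / (q - s)) := by
      have h6 : 0 ≤ 4 * (q : ℝ) * (1 / s) := by positivity
      have h7 : 0 ≤ 4 * (q : ℝ) * (1 / (q - s)) := by positivity
      rw [one_div_div]
      rcases min_choice (s : ℝ) (q - s) with h8 | h8 <;> rw [h8, div_eq_mul_one_div] <;> linarith
    refine h5.trans ?_
    rw [residueMajorant]
    refine le_add_of_nonneg_right ?_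
    split_ifs <;> positivity
  · have h3 : s * P ^ 3 < 250 * q * h := by
      rw [hV, div_lt_div_iff₀ (by positivity) (by positivity)] at hVs
      linarith
    have h4 : (s : ℝ) ≤ 250 * q / P := by
      rw [le_div_iff₀ hP0]
      have : s * P ^ 3 < 250 * q * P ^ 2 := h3.trans_le (by gcongr)
      have h5 : s * P * P ^ 2 < 250 * q * P ^ 2 := by linarith
      exact (lt_of_mul_lt_mul_right h5 (by positivity)).le
    rw [residueMajorant, if_pos h4]
    have h5 : 10 * P ^ 3 * (1 / √h) ≤ 10 * √(250 * q * P ^ 3) * (1 / √s) := by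
      have h6 : P ^ 3 * √s ≤ √(250 * q * P ^ 3) * √h := by
        rw [← Real.sqrt_mul (by positivity)]
        refine Real.le_sqrt_of_sq_le ?_
        rw [mul_pow, Real.sq_sqrt hs0.le]
        nlinarith [pow_pos hP0 3]
      have h7 : 0 < √(h : ℝ) := Real.sqrt_pos.2 hh0
      have h8 : 0 < √(s : ℝ) := Real.sqrt_pos.2 hs0
      rw [mul_one_div, mul_one_div, div_le_div_iff₀ h7 h8]
      linarith
    refine (norm_corr_le hP hM h1 h2 hh hhP).trans (h5.trans (le_add_of_nonneg_left ?_))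
    positivity

theorem sum_multiples_one_div_sqrt_le (hq : 1 ≤ q) (H : ℕ) :
    ∑ h ∈ Ico 1 H with q ∣ h, 1 / √(h : ℝ) ≤ 2 * √H / q := by
  have hq0 : (0 : ℝ) < q := by exact_mod_cast hq
  have hinj : Set.InjOn (fun j => q * j) (range (H / q + 1)) := by
    intro i _ j _ hij
    exact Nat.eq_of_mul_eq_mul_left (by omega) hij
  have hsub : {h ∈ Ico 1 H | q ∣ h} ⊆ (range (H / q + 1)).image fun j => q * j := by
    intro h hh
    rw [mem_filter, mem_Ico] at hh
    obtain ⟨j, rfl⟩ := hh.2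
    refine mem_image.2 ⟨j, mem_range.2 (Nat.lt_succ_of_le ?_), rfl⟩
    rw [Nat.le_div_iff_mul_le (by omega)]
    linarith [hh.1.2]
  refine (sum_le_sum_of_subset_of_nonneg hsub fun _ _ _ => by positivity).trans ?_
  rw [sum_image hinj]
  have h1 : ∀ j ∈ range (H / q + 1), 1 / √((q * j : ℕ) : ℝ) = 1 / √q * (1 / √j) := by
    intro j _
    push_cast
    rw [Real.sqrt_mul hq0.le, one_div_mul_one_div]
  rw [sum_congr rfl h1, ← mul_sum]
  have h2 : √((H / q : ℕ) : ℝ) ≤ √H / √q := by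
    rw [← Real.sqrt_div (by positivity)]
    exact Real.sqrt_le_sqrt Nat.cast_div_le
  have h3 : 0 < √(q : ℝ) := Real.sqrt_pos.2 hq0
  calc _ ≤ 1 / √q * (2 * (√H / √q)) := by
        gcongr
        exact (sum_one_div_sqrt_le' _).trans (by gcongr)
    _ = 2 * √H / (√q * √q) := by field_simp
    _ = _ := by rw [Real.mul_self_sqrt hq0.le]

/-- The exponential sum when the second difference is close to a rational with denominator at
least `P`. -/
theorem norm_sum_le_of_large_denominator (hP : 1000 ≤ P) (hM : (M : ℝ) ≤ P ^ 3)
    (h1 : ∀ n < M, 1 / P ^ 6 ≤ secondDiff f (n + 1) - secondDiff f n)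
    (h2 : ∀ n < M, secondDiff f (n + 1) - secondDiff f n ≤ 125 * (1 / P ^ 6))
    {H : ℕ} (hH : (H : ℝ) ≤ P ^ 2) (hH' : P ^ 2 / 2 ≤ H) (hqP : P ≤ q) (hqH : q ≤ 4 * H)
    (hc : IsCoprime (q : ℤ) a) (ha : 4 * H * |q * secondDiff f 0 - a| ≤ 1) :
    ‖∑ n ∈ range M, e2pi (f n)‖ ≤ 500 * P ^ 2 := by
  have hP0 : 0 < P := by linarith
  have hq0 : (0 : ℝ) < q := by linarith
  have hq : 1 ≤ q := by exact_mod_cast hq0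
  have hH0 : (0 : ℝ) < H := lt_of_lt_of_le (by positivity) hH'
  have hH1 : 1 ≤ H := by exact_mod_cast hH0
  set B := H / q + 1 with hB
  have hBH : H ≤ q * B := by
    have := Nat.lt_mul_div_succ H (show 0 < q by omega)
    exact this.le
  have hBq : (q * B : ℝ) ≤ 5 * P ^ 2 := by
    have h3 : q * B ≤ 5 * H := by
      have := Nat.mul_div_le H q
      rw [hB, mul_add]
      omega
    have h4 : (q * B : ℝ) ≤ 5 * H := by exact_mod_cast h3
    linarith
  have hpt : ∀ h ∈ Ico 1 H, corrNorm (fun n => e2pi (f n)) M (1 * h) ≤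
      residueMajorant P q (negResidue a q h) + if q ∣ h then 10 * P ^ 3 * (1 / √h) else 0 := by
    intro h hh
    rw [mem_Ico] at hh
    have hhH : (h : ℝ) ≤ H := by exact_mod_cast hh.2.le
    have hnn := residueMajorant_nonneg (P := P) (negResidue_lt hq a h)
    rw [one_mul, corrNorm_e2pi]
    split_ifs with hd
    · have := norm_corr_le hP hM h1 h2 hh.1 (hhH.trans hH)
      linarith
    · obtain ⟨m, hm⟩ := exists_mul_eq_sub_negResidue hq a h
      rw [add_zero]
      refine norm_corr_le_residueMajorant hP hM h1 h2 hh.1 (hhH.trans hH) ?_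
        (negResidue_lt hq a h) hm (le_trans (by gcongr) ha)
      refine Nat.one_le_iff_ne_zero.2 fun h0 => hd ?_
      rw [h0, Nat.cast_zero, sub_zero] at hm
      exact_mod_cast hc.dvd_of_dvd_mul_right (Dvd.intro_left m hm.symm)
  have hsum : ∑ h ∈ Ico 1 H, corrNorm (fun n => e2pi (f n)) M (1 * h) ≤ 25180 * P ^ 3 := by
    refine (sum_le_sum hpt).trans ?_
    rw [sum_add_distrib, ← sum_filter, ← mul_sum]
    have hsq : √(q : ℝ) ≤ 2 * P := by
      rw [Real.sqrt_le_left (by positivity)]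
      have : (q : ℝ) ≤ 4 * H := by exact_mod_cast hqH
      nlinarith
    have hsH : √(H : ℝ) ≤ P := by
      rw [Real.sqrt_le_left hP0.le]
      exact hH
    have h3 : ∑ h ∈ Ico 1 H, residueMajorant P q (negResidue a q h) ≤ 25160 * P ^ 3 := by
      calc _ ≤ ∑ h ∈ range (q * B), residueMajorant P q (negResidue a q h) := by
            refine sum_le_sum_of_subset_of_nonneg (fun h hh => ?_) fun h _ _ =>
              residueMajorant_nonneg (negResidue_lt hq a h)
            rw [mem_Ico] at hh
            rw [mem_range]
            omega
        _ ≤ B * ∑ s ∈ range q, residueMajorant P q s :=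
            sum_negResidue_le hq hc _ (fun s hs => residueMajorant_nonneg hs) B
        _ ≤ B * (q * (16 * √q + 5000 * P)) := by
            gcongr
            exact sum_residueMajorant_le hP0 hq
        _ = (q * B) * (16 * √q + 5000 * P) := by ring
        _ ≤ (5 * P ^ 2) * (16 * (2 * P) + 5000 * P) := by gcongr
        _ = _ := by ring
    have h4 : ∑ h ∈ Ico 1 H with q ∣ h, 1 / √(h : ℝ) ≤ 2 := by
      refine (sum_multiples_one_div_sqrt_le hq H).trans ?_
      rw [div_le_iff₀ hq0]
      linarith
    have h5 : 10 * P ^ 3 * ∑ h ∈ Ico 1 H with q ∣ h, 1 / √(h : ℝ) ≤ 10 * P ^ 3 * 2 := by gcongr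
    linarith
  have hvdc := van_der_corput (fun n => e2pi (f n)) (fun n => (norm_e2pi _).le) M 1 H hH1
    (L := P ^ 3) hM (by
      push_cast
      nlinarith [pow_pos hP0 2])
  have hnn : 0 ≤ ∑ h ∈ Ico 1 H, corrNorm (fun n => e2pi (f n)) M (1 * h) :=
    sum_nonneg fun _ _ => norm_nonneg _
  have hfin : ‖∑ n ∈ range M, e2pi (f n)‖ ^ 2 ≤ (500 * P ^ 2) ^ 2 := by
    calc _ ≤ _ := hvdc
      _ ≤ 2 * P ^ 3 / (P ^ 2 / 2) * (P ^ 3 + 2 * (25180 * P ^ 3)) := by gcongr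
      _ = 201444 * P ^ 4 := by field_simp; norm_num
      _ ≤ _ := by nlinarith [pow_pos hP0 4]
  exact (abs_le_of_sq_le_sq' hfin (by positivity)).2

end LargeDenominator

/-- The constant in the third-derivative test on a block of length at most `P ^ 3`. -/
noncomputable def blockConst : ℝ := 2300 + 32 / (1 - dyadicRatio)

theorem le_blockConst : 500 ≤ blockConst := by
  have h1 : 0 < 1 - dyadicRatio := by linarith [dyadicRatio_lt_one]
  have h2 : 0 < 32 / (1 - dyadicRatio) := by positivity
  rw [blockConst]
  linarith

theorem third_derivative_test_block {f : ℕ → ℝ} {M : ℕ} {P : ℝ} (hP : 1000 ≤ P)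
    (hM : (M : ℝ) ≤ P ^ 3)
    (h1 : ∀ n < M, 1 / P ^ 6 ≤ secondDiff f (n + 1) - secondDiff f n)
    (h2 : ∀ n < M, secondDiff f (n + 1) - secondDiff f n ≤ 125 * (1 / P ^ 6)) :
    ‖∑ n ∈ range M, e2pi (f n)‖ ≤ blockConst * P ^ 2 := by
  have hP0 : 0 < P := by linarith
  set H := ⌊P ^ 2⌋₊ with hH
  have hHle : (H : ℝ) ≤ P ^ 2 := Nat.floor_le (by positivity)
  have hHge : P ^ 2 / 2 ≤ H := by
    have := Nat.lt_floor_add_one (P ^ 2)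
    rw [← hH] at this
    nlinarith
  have hH0 : (0 : ℝ) < H := lt_of_lt_of_le (by positivity) hHge
  have hH1 : 0 < H := by exact_mod_cast hH0
  obtain ⟨x, hx, hxd⟩ := Real.exists_rat_abs_sub_le_and_den_le (secondDiff f 0)
    (show 0 < 4 * H by omega)
  have hd0 : (0 : ℝ) < x.den := by exact_mod_cast x.den_pos
  have ha : |x.den * secondDiff f 0 - x.num| ≤ 1 / (4 * H) := by
    have h3 : x.den * secondDiff f 0 - x.num = x.den * (secondDiff f 0 - x) := by
      rw [Rat.cast_def]
      field_simp
    rw [h3, abs_mul, abs_of_pos hd0]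
    calc (x.den : ℝ) * |secondDiff f 0 - x| ≤ x.den * (1 / (((4 * H : ℕ) + 1) * x.den)) := by gcongr
      _ = 1 / (4 * H + 1) := by push_cast; field_simp
      _ ≤ _ := by gcongr; linarith
  rcases le_or_gt (x.den : ℝ) P with hq | hq
  · refine norm_sum_le_of_small_denominator hP hM h1 h2 x.den_pos hq (ha.trans ?_)
    gcongr
    linarith
  · have hc : IsCoprime (x.den : ℤ) x.num := by
      rw [Int.isCoprime_iff_gcd_eq_one, Int.gcd_comm]
      simpa [Int.gcd, Nat.Coprime] using x.reduced
    refine (norm_sum_le_of_large_denominator hP hM h1 h2 hHle hHge hq.le hxd hc ?_).trans ?_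
    · rw [le_div_iff₀ (by positivity)] at ha
      linarith
    · gcongr
      exact le_blockConst

theorem third_derivative_test_of_large {f : ℕ → ℝ} {M : ℕ} {P : ℝ} (hP : 1000 ≤ P)
    (h1 : ∀ n < M, 1 / P ^ 6 ≤ secondDiff f (n + 1) - secondDiff f n)
    (h2 : ∀ n < M, secondDiff f (n + 1) - secondDiff f n ≤ 125 * (1 / P ^ 6)) :
    ‖∑ n ∈ range M, e2pi (f n)‖ ≤ blockConst * P ^ 2 * (2 * M / P ^ 3 + 1) := by
  have hP0 : 0 < P := by linarith
  have hK : 0 < blockConst := by linarith [le_blockConst]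
  have hP3 : 1 ≤ P ^ 3 := one_le_pow₀ (by linarith)
  induction M using Nat.strong_induction_on generalizing f with
  | _ M ih =>
    rcases le_or_gt (M : ℝ) (P ^ 3) with hM | hM
    · refine (third_derivative_test_block hP hM h1 h2).trans (le_mul_of_one_le_right ?_ ?_)
      · positivity
      · have : 0 ≤ 2 * M / P ^ 3 := by positivity
        linarith
    · set B := ⌊P ^ 3⌋₊ with hB
      have hBle : (B : ℝ) ≤ P ^ 3 := Nat.floor_le (by positivity)
      have hBge : P ^ 3 ≤ 2 * B := by
        have h3 := Nat.lt_floor_add_one (P ^ 3)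
        have h4 : (1 : ℝ) ≤ B := by exact_mod_cast Nat.le_floor (by exact_mod_cast hP3)
        rw [← hB] at h3
        rcases le_or_gt 2 (P ^ 3) with h5 | h5 <;> linarith
      have hB0 : 0 < B := Nat.floor_pos.2 hP3
      have hBM : B < M := by
        have : (B : ℝ) < M := hBle.trans_lt hM
        exact_mod_cast this
      have e1 := third_derivative_test_block hP hBle (fun n hn => h1 n (by omega))
        (fun n hn => h2 n (by omega))
      have e2 := ih (M - B) (by omega) (f := fun n => f (B + n))
        (fun n hn => h1 (B + n) (by omega)) (fun n hn => h2 (B + n) (by omega))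
      have e3 : range M = range (B + (M - B)) := by rw [Nat.add_sub_cancel' hBM.le]
      rw [e3, sum_range_add]
      refine (norm_add_le _ _).trans ((add_le_add e1 e2).trans ?_)
      rw [Nat.cast_sub hBM.le]
      have e4 : 1 ≤ 2 * B / P ^ 3 := by rwa [one_le_div (by positivity)]
      have e5 : 2 * (M - B : ℝ) / P ^ 3 = 2 * M / P ^ 3 - 2 * B / P ^ 3 := by ring
      rw [e5]
      nlinarith [mul_pos hK (pow_pos hP0 2)]

/-- The third-derivative test: if the third differences of `f` have order `1 / P ^ 6`, then the
exponential sum of length `M` is `O(M / P + P ^ 2)`. -/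
theorem third_derivative_test : ∃ K > 0, ∀ (f : ℕ → ℝ) (M : ℕ) (P : ℝ), 0 < P →
    (∀ n < M, 1 / P ^ 6 ≤ secondDiff f (n + 1) - secondDiff f n) →
    (∀ n < M, secondDiff f (n + 1) - secondDiff f n ≤ 125 * (1 / P ^ 6)) →
    ‖∑ n ∈ range M, e2pi (f n)‖ ≤ K * (M / P + P ^ 2) := by
  have hK : 0 < blockConst := by linarith [le_blockConst]
  refine ⟨2 * blockConst + 1000, by positivity, fun f M P hP0 h1 h2 => ?_⟩
  have hMP : 0 ≤ M / P := by positivity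
  rcases le_or_gt 1000 P with hP | hP
  · refine (third_derivative_test_of_large hP h1 h2).trans ?_
    have : blockConst * P ^ 2 * (2 * M / P ^ 3 + 1) =
        2 * blockConst * (M / P) + blockConst * P ^ 2 := by field_simp
    rw [this]
    nlinarith [pow_pos hP0 2]
  · have h3 := norm_sum_e2pi_le f (range M)
    rw [card_range] at h3
    have h4 : (M : ℝ) = P * (M / P) := by field_simp
    have h5 : P * (M / P) ≤ 1000 * (M / P) := by gcongr
    nlinarith [pow_pos hP0 2, mul_nonneg hK.le hMP]

theorem exists_third_difference_eq {F F₁ F₂ F₃ : ℝ → ℝ} (h₁ : ∀ x > 0, HasDerivAt F (F₁ x) x)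
    (h₂ : ∀ x > 0, HasDerivAt F₁ (F₂ x) x) (h₃ : ∀ x > 0, HasDerivAt F₂ (F₃ x) x) {y : ℝ}
    (hy : 0 < y) :
    ∃ ξ, y < ξ ∧ ξ < y + 3 ∧ F (y + 3) - 3 * F (y + 2) + 3 * F (y + 1) - F y = F₃ ξ := by
  have key : ∀ G G' : ℝ → ℝ, (∀ x > 0, HasDerivAt G (G' x) x) → ∀ x > 0,
      ∃ ξ, x < ξ ∧ ξ < x + 1 ∧ G (x + 1) - G x = G' ξ := by
    intro G G' hG x hx
    obtain ⟨ξ, hξ, h⟩ := exists_hasDerivAt_eq_slope G G' (show x < x + 1 by linarith)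
      (fun t ht => (hG t (by linarith [ht.1])).continuousAt.continuousWithinAt)
      (fun t ht => hG t (by linarith [ht.1]))
    exact ⟨ξ, hξ.1, hξ.2, by rw [h]; simp⟩
  have shift : ∀ G G' : ℝ → ℝ, (∀ x > 0, HasDerivAt G (G' x) x) → ∀ x > 0,
      HasDerivAt (fun x => G (x + 1) - G x) (G' (x + 1) - G' x) x := fun G G' hG x hx =>
    ((hG (x + 1) (by linarith)).comp_add_const x 1).sub (hG x hx)
  obtain ⟨ξ₁, a1, b1, e1⟩ := key _ _ (shift _ _ (shift _ _ h₁)) y hy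
  obtain ⟨ξ₂, a2, b2, e2⟩ := key _ _ (shift _ _ h₂) ξ₁ (by linarith)
  obtain ⟨ξ₃, a3, b3, e3⟩ := key _ _ h₃ ξ₂ (by linarith)
  refine ⟨ξ₃, by linarith, by linarith, ?_⟩
  rw [← e3, ← e2, ← e1]
  ring_nf

theorem third_difference_rpow_bounds {γ : ℝ} (hγ1 : 0 < γ) (hγ2 : γ < 1) {X y : ℝ} (hX : 1 ≤ X)
    (hXy : X ≤ y) (hyX : y ≤ 2 * X) :
    γ * (1 - γ) * (2 - γ) * (5 * X) ^ (γ - 3) ≤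
        (y + 3) ^ γ - 3 * (y + 2) ^ γ + 3 * (y + 1) ^ γ - y ^ γ ∧
      (y + 3) ^ γ - 3 * (y + 2) ^ γ + 3 * (y + 1) ^ γ - y ^ γ ≤
        125 * (γ * (1 - γ) * (2 - γ) * (5 * X) ^ (γ - 3)) := by
  have hd : ∀ p : ℝ, ∀ x > 0, HasDerivAt (fun x : ℝ => x ^ p) (p * x ^ (p - 1)) x := fun p x hx =>
    Real.hasDerivAt_rpow_const (Or.inl hx.ne')
  obtain ⟨ξ, a1, b1, e1⟩ := exists_third_difference_eq (hd γ)
    (fun x hx => (hd (γ - 1) x hx).const_mul γ)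
    (fun x hx => ((hd (γ - 1 - 1) x hx).const_mul (γ - 1)).const_mul γ)
    (show 0 < y by linarith)
  have h1 : 0 < 1 - γ := by linarith
  have h2 : 0 < 2 - γ := by linarith
  have hX0 : 0 < X := by linarith
  rw [e1, show γ - 1 - 1 - 1 = γ - 3 by ring,
    show γ * ((γ - 1) * ((γ - 1 - 1) * ξ ^ (γ - 3))) = γ * (1 - γ) * (2 - γ) * ξ ^ (γ - 3) by ring]
  constructor
  · have h3 : (5 * X) ^ (γ - 3) ≤ ξ ^ (γ - 3) :=
      Real.rpow_le_rpow_of_nonpos (by linarith) (by linarith) (by linarith)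
    gcongr
  · have h3 : ξ ^ (γ - 3) ≤ X ^ (γ - 3) :=
      Real.rpow_le_rpow_of_nonpos hX0 (by linarith) (by linarith)
    have h4 : 1 ≤ 125 * (5 : ℝ) ^ (γ - 3) := by
      calc (1 : ℝ) = 125 * (5 : ℝ) ^ (-3 : ℝ) := by norm_num [Real.rpow_neg]
        _ ≤ _ := by
          gcongr
          · norm_num
          · linarith
    have h5 : X ^ (γ - 3) ≤ 125 * (5 * X) ^ (γ - 3) := by
      rw [Real.mul_rpow (by norm_num) hX0.le, ← mul_assoc]
      exact le_mul_of_one_le_left (by positivity) h4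
    calc _ ≤ γ * (1 - γ) * (2 - γ) * (125 * (5 * X) ^ (γ - 3)) := by
          gcongr
          exact h3.trans h5
      _ = _ := by ring

theorem sum_Ioc_int_eq_sum_range (F : ℤ → ℂ) (A B : ℤ) :
    ∑ l ∈ Ioc A B, F l = ∑ n ∈ range (B - A).toNat, F (A + 1 + n) := by
  refine sum_nbij' (fun l => (l - A - 1).toNat) (fun n => A + 1 + n) ?_ ?_ ?_ ?_ ?_
  · intro l hl
    rw [mem_Ioc] at hl
    rw [mem_range]
    omega
  · intro n hn
    rw [mem_range] at hn
    rw [mem_Ioc]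
    omega
  · intro l hl
    rw [mem_Ioc] at hl
    omega
  · intro n _
    omega
  · intro l hl
    rw [mem_Ioc] at hl
    congr 1
    omega

theorem mul_rpow_mul_eq {c m d N γ p : ℝ} (hc : 0 < c) (hm : 0 < m) (hd : 0 < d) (hN : 0 < N) :
    (c * m * d ^ (3 : ℝ) * N ^ (γ - 3)) ^ p =
      c ^ p * m ^ p * d ^ (3 * p) * N ^ ((γ - 3) * p) := by
  rw [Real.mul_rpow (by positivity) (by positivity), Real.mul_rpow (by positivity) (by positivity),
    Real.mul_rpow hc.le hm.le, Real.rpow_mul hd.le, Real.rpow_mul hN.le]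

theorem inner_exp_sum_bound (γ : ℝ) (hγ1 : 0 < γ) (hγ2 : γ < 1) :
    ∃ C > 0, ∀ (α : ℝ) (h m d : ℕ) (N₁ N₂ : ℝ),
      0 < h → 0 < m → 0 < d → 2 ≤ N₁ → N₁ < N₂ → N₂ ≤ 2 * N₁ → (d : ℝ) ≤ N₁ →
      ‖∑ l ∈ Finset.Ioc ⌊N₁ / (d : ℝ)⌋ ⌊N₂ / (d : ℝ)⌋,
          e2pi (α * (h : ℝ) * (d : ℝ) ^ 2 * (l : ℝ) ^ 2 -
            (m : ℝ) * (d : ℝ) ^ γ * (l : ℝ) ^ γ)‖ ≤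
      C * ((m : ℝ) ^ ((1 : ℝ) / 6) * (d : ℝ) ^ (-(1 : ℝ) / 2) * N₁ ^ (γ / 6 + 1 / 2) +
        (m : ℝ) ^ (-(1 : ℝ) / 3) * (d : ℝ) ^ (-(1 : ℝ)) * N₁ ^ (1 - γ / 3)) := by
  obtain ⟨K, hK, htest⟩ := third_derivative_test
  have hγ3 : 0 < 1 - γ := by linarith
  have hγ4 : 0 < 2 - γ := by linarith
  set c : ℝ := γ * (1 - γ) * (2 - γ) * 5 ^ (γ - 3) with hc
  have hc0 : 0 < c := by positivity
  refine ⟨K * (2 * c ^ ((1 : ℝ) / 6) + c ^ (-(1 : ℝ) / 3)), by positivity, ?_⟩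
  intro α h m d N₁ N₂ _ hm hd hN₁ hN hN₂ hdN
  have hm0 : (0 : ℝ) < m := by exact_mod_cast hm
  have hd0 : (0 : ℝ) < d := by exact_mod_cast hd
  have hN0 : 0 < N₁ := by linarith
  set X : ℝ := N₁ / d with hX
  have hX1 : 1 ≤ X := by rwa [hX, one_le_div hd0]
  have hX2 : N₂ / d ≤ 2 * X := by
    rw [hX, ← mul_div_assoc]
    gcongr
  set lam : ℝ := c * m * (d : ℝ) ^ (3 : ℝ) * N₁ ^ (γ - 3) with hlam
  have hlam0 : 0 < lam := by positivity
  have hlamX : lam = m * (d : ℝ) ^ γ * (γ * (1 - γ) * (2 - γ) * (5 * X) ^ (γ - 3)) := by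
    rw [hlam, hc, hX, Real.mul_rpow (by norm_num) (by positivity), Real.div_rpow hN0.le hd0.le]
    have : (d : ℝ) ^ γ = (d : ℝ) ^ (3 : ℝ) * (d : ℝ) ^ (γ - 3) := by
      rw [← Real.rpow_add hd0]
      ring_nf
    rw [this]
    field_simp
  set P : ℝ := lam ^ (-(1 : ℝ) / 6) with hP
  have hP0 : 0 < P := by positivity
  have hP6 : 1 / P ^ 6 = lam := by
    rw [hP, ← Real.rpow_natCast, ← Real.rpow_mul hlam0.le, one_div, ← Real.rpow_neg hlam0.le]
    norm_num
  have hPi : 1 / P = lam ^ ((1 : ℝ) / 6) := by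
    rw [hP, one_div, ← Real.rpow_neg hlam0.le]
    norm_num
  have hP2 : P ^ 2 = lam ^ (-(1 : ℝ) / 3) := by
    rw [hP, ← Real.rpow_natCast, ← Real.rpow_mul hlam0.le]
    norm_num
  set A := ⌊X⌋ with hA
  set M := (⌊N₂ / (d : ℝ)⌋ - A).toNat with hM
  have hXA : X < A + 1 := Int.lt_floor_add_one X
  have hAX : (A : ℝ) ≤ X := Int.floor_le X
  have hBle : (⌊N₂ / (d : ℝ)⌋ : ℝ) ≤ 2 * X := (Int.floor_le _).trans hX2
  have hMle : (M : ℝ) ≤ 2 * X := by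
    rcases le_or_gt ⌊N₂ / (d : ℝ)⌋ A with h3 | h3
    · rw [hM, Int.toNat_of_nonpos (by omega)]
      simp
      linarith
    · have h4 : (M : ℤ) = ⌊N₂ / (d : ℝ)⌋ - A := Int.toNat_of_nonneg (by omega)
      have h5 : (M : ℝ) = ⌊N₂ / (d : ℝ)⌋ - A := by exact_mod_cast h4
      linarith
  set f : ℕ → ℝ := fun n => -(α * h * (d : ℝ) ^ 2 * ((A + 1 + n : ℤ) : ℝ) ^ 2 -
    m * (d : ℝ) ^ γ * ((A + 1 + n : ℤ) : ℝ) ^ γ) with hf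
  have hthird : ∀ n < M, lam ≤ secondDiff f (n + 1) - secondDiff f n ∧
      secondDiff f (n + 1) - secondDiff f n ≤ 125 * lam := by
    intro n hn
    set y : ℝ := A + 1 + n with hy
    have hn0 : (0 : ℝ) ≤ n := by positivity
    have hyX : y ≤ 2 * X := by
      have h3 : A + 1 + n ≤ ⌊N₂ / (d : ℝ)⌋ := by omega
      have h4 : y ≤ (⌊N₂ / (d : ℝ)⌋ : ℝ) := by rw [hy]; exact_mod_cast h3
      linarith
    have h5 := third_difference_rpow_bounds hγ1 hγ2 hX1 (show X ≤ y by linarith) hyX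
    have h6 : secondDiff f (n + 1) - secondDiff f n = m * (d : ℝ) ^ γ *
        ((y + 3) ^ γ - 3 * (y + 2) ^ γ + 3 * (y + 1) ^ γ - y ^ γ) := by
      simp only [secondDiff, hf]
      push_cast
      rw [show (A + 1 + (n + 1 + 2) : ℝ) = y + 3 by rw [hy]; ring,
        show (A + 1 + (n + 1 + 1) : ℝ) = y + 2 by rw [hy]; ring,
        show (A + 1 + (n + 1) : ℝ) = y + 1 by rw [hy]; ring,
        show (A + 1 + (n + 2) : ℝ) = y + 2 by rw [hy]; ring, ← hy]
      ring
    have h7 : 0 < m * (d : ℝ) ^ γ := by positivity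
    rw [h6, hlamX]
    refine ⟨mul_le_mul_of_nonneg_left h5.1 h7.le,
      (mul_le_mul_of_nonneg_left h5.2 h7.le).trans (le_of_eq (by ring))⟩
  have hmain := htest f M P hP0 (fun n hn => by rw [hP6]; exact (hthird n hn).1)
    (fun n hn => by rw [hP6]; exact (hthird n hn).2)
  rw [sum_Ioc_int_eq_sum_range (fun l : ℤ => e2pi (α * h * (d : ℝ) ^ 2 * (l : ℝ) ^ 2 -
    m * (d : ℝ) ^ γ * (l : ℝ) ^ γ)), ← norm_sum_e2pi_neg]
  refine hmain.trans ?_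
  have hT1 : X * (1 / P) = c ^ ((1 : ℝ) / 6) *
      ((m : ℝ) ^ ((1 : ℝ) / 6) * (d : ℝ) ^ (-(1 : ℝ) / 2) * N₁ ^ (γ / 6 + 1 / 2)) := by
    have e1 : N₁ ^ (γ / 6 + 1 / 2) = N₁ * N₁ ^ ((γ - 3) * (1 / 6)) := by
      nth_rewrite 2 [← Real.rpow_one N₁]
      rw [← Real.rpow_add hN0]
      ring_nf
    have e2 : (d : ℝ) ^ (3 * (1 / 6) : ℝ) = d * (d : ℝ) ^ (-(1 : ℝ) / 2) := by
      nth_rewrite 2 [← Real.rpow_one (d : ℝ)]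
      rw [← Real.rpow_add hd0]
      norm_num
    rw [hPi, hlam, mul_rpow_mul_eq hc0 hm0 hd0 hN0, e1, e2, hX]
    field_simp
  have hT2 : P ^ 2 = c ^ (-(1 : ℝ) / 3) *
      ((m : ℝ) ^ (-(1 : ℝ) / 3) * (d : ℝ) ^ (-(1 : ℝ)) * N₁ ^ (1 - γ / 3)) := by
    rw [hP2, hlam, mul_rpow_mul_eq hc0 hm0 hd0 hN0]
    ring_nf
  set T₁ : ℝ := (m : ℝ) ^ ((1 : ℝ) / 6) * (d : ℝ) ^ (-(1 : ℝ) / 2) * N₁ ^ (γ / 6 + 1 / 2) with hT₁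
  set T₂ : ℝ := (m : ℝ) ^ (-(1 : ℝ) / 3) * (d : ℝ) ^ (-(1 : ℝ)) * N₁ ^ (1 - γ / 3) with hT₂
  have hT₁0 : 0 < T₁ := by positivity
  have hT₂0 : 0 < T₂ := by positivity
  have hc1 : 0 < c ^ ((1 : ℝ) / 6) := by positivity
  have hc2 : 0 < c ^ (-(1 : ℝ) / 3) := by positivity
  have hMP : M / P ≤ 2 * (c ^ ((1 : ℝ) / 6) * T₁) := by
    rw [← hT1, div_eq_mul_one_div, ← mul_assoc]
    gcongr
  calc K * (M / P + P ^ 2) ≤ K * (2 * (c ^ ((1 : ℝ) / 6) * T₁) + c ^ (-(1 : ℝ) / 3) * T₂) := by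
        rw [hT2]
        gcongr
    _ ≤ K * ((2 * c ^ ((1 : ℝ) / 6) + c ^ (-(1 : ℝ) / 3)) * (T₁ + T₂)) := by
        gcongr
        nlinarith [mul_pos hc1 hT₂0, mul_pos hc2 hT₁0]
    _ = _ := by ring
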